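/- arXiv:2301.13026 — 2 statements merged into one kernel-verified Lean document; each statement's English description precedes it below -/
import Mathlib

section
/- Let 1 ≤ q < p < ∞ and let Ω ⊊ ℝ^N be open with λ_{p,q}(Ω) > 0, where λ_{p,q}(Ω) = inf{∫_Ω|∇ψ|^p : ψ ∈ C_0^∞(Ω), ‖ψ‖_{L^q} = 1}. Then d_Ω ∈ L^{pq/(p-q)}(Ω), and λ_{p,q}(Ω) · (∫_Ω d_Ω^{pq/(p-q)} dx)^{(p-q)/q} ≤ λ_p(B_1), where λ_p(B_1) = λ_{p,p}(B_1) is the first Dirichlet p-eigenvalue of the unit ball. -/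
open Set Metric MeasureTheory

/-- The generalized principal frequency
`λ_{p,q}(Ω) = inf {∫_Ω |∇ψ|^p : ψ ∈ C_0^∞(Ω), ‖ψ‖_{L^q(Ω)} = 1}`. -/
noncomputable def lambdaPQ {N : ℕ} (p q : ℝ) (Ω : Set (EuclideanSpace ℝ (Fin N))) : ℝ :=
  sInf {E : ℝ | ∃ ψ : EuclideanSpace ℝ (Fin N) → ℝ, ContDiff ℝ (⊤ : ℕ∞) ψ ∧
    HasCompactSupport ψ ∧ tsupport ψ ⊆ Ω ∧
    (∫ x in Ω, |ψ x| ^ q) = 1 ∧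
    E = ∫ x in Ω, ‖gradient ψ x‖ ^ p}

section DistSumm
open Filter Topology
open scoped NNReal ENNReal

/-- Nonnegative Lipschitz functions with compact support in `Ω`. -/
structure Adm {N : ℕ} (Ω : Set (EuclideanSpace ℝ (Fin N))) (u : EuclideanSpace ℝ (Fin N) → ℝ) :
    Prop where
  lip : ∃ K : ℝ≥0, LipschitzWith K u
  cpt : HasCompactSupport u
  sub : tsupport u ⊆ Ω
  nonneg : ∀ x, 0 ≤ u x

noncomputable def En {N : ℕ} (p : ℝ) (u : EuclideanSpace ℝ (Fin N) → ℝ) : ℝ :=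
  ∫ x, ‖fderiv ℝ u x‖ ^ p

noncomputable def Qn {N : ℕ} (p : ℝ) (u : EuclideanSpace ℝ (Fin N) → ℝ) : ℝ :=
  ∫ x, u x ^ p

variable {N : ℕ} {Ω : Set (EuclideanSpace ℝ (Fin N))} {u v a b : EuclideanSpace ℝ (Fin N) → ℝ}

lemma lip_grad_integrable {p : ℝ} (hp : 0 < p) {K : ℝ≥0} (hL : LipschitzWith K u)
    (hc : HasCompactSupport u) : Integrable (fun x => ‖fderiv ℝ u x‖ ^ p) := by
  have hm : AEStronglyMeasurable (fun x => ‖fderiv ℝ u x‖ ^ p) volume :=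
    (((measurable_fderiv ℝ u).norm).pow_const p).aestronglyMeasurable
  have h0 : ∀ x ∉ tsupport u, ‖fderiv ℝ u x‖ ^ p = 0 := by
    intro x hx
    have : fderiv ℝ u x = 0 := by
      by_contra h
      exact hx (support_fderiv_subset ℝ h)
    rw [this, norm_zero, Real.zero_rpow hp.ne']
  have hs : IntegrableOn (fun x => ‖fderiv ℝ u x‖ ^ p) (tsupport u) := by
    refine Measure.integrableOn_of_bounded (M := (K : ℝ) ^ p) hc.measure_lt_top.ne
      hm (Eventually.of_forall fun x => ?_)
    rw [Real.norm_of_nonneg (by positivity)]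
    exact Real.rpow_le_rpow (norm_nonneg _) (norm_fderiv_le_of_lipschitz ℝ hL) hp.le
  rwa [integrableOn_iff_integrable_of_support_subset] at hs
  intro x hx
  by_contra h
  exact hx (h0 x h)

lemma cont_pow_integrable {p : ℝ} (hp : 0 < p) (hu : Continuous u)
    (hc : HasCompactSupport u) : Integrable (fun x => |u x| ^ p) := by
  refine Continuous.integrable_of_hasCompactSupport ?_ ?_
  · exact hu.abs.rpow_const fun _ => Or.inr hp.le
  · refine hc.mono fun x hx => ?_
    contrapose! hx
    simp only [Function.mem_support, not_not] at hx ⊢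
    rw [hx, abs_zero, Real.zero_rpow hp.ne']

namespace Adm

lemma continuous (h : Adm Ω u) : Continuous u := by
  obtain ⟨K, hK⟩ := h.lip
  exact hK.continuous

lemma ae_diff (h : Adm Ω u) : ∀ᵐ x, DifferentiableAt ℝ u x := by
  obtain ⟨K, hK⟩ := h.lip
  exact hK.ae_differentiableAt

lemma intE (h : Adm Ω u) {p : ℝ} (hp : 0 < p) : Integrable (fun x => ‖fderiv ℝ u x‖ ^ p) := by
  obtain ⟨K, hK⟩ := h.lip
  exact lip_grad_integrable hp hK h.cpt

lemma intQ (h : Adm Ω u) {p : ℝ} (hp : 0 < p) : Integrable (fun x => u x ^ p) := by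
  simpa only [abs_of_nonneg (h.nonneg _)] using cont_pow_integrable hp h.continuous h.cpt

lemma of_support (hl : ∃ K : ℝ≥0, LipschitzWith K u) {C : Set (EuclideanSpace ℝ (Fin N))}
    (hC : IsCompact C) (hCΩ : C ⊆ Ω) (hs : ∀ x, x ∉ C → u x = 0) (h0 : ∀ x, 0 ≤ u x) : Adm Ω u := by
  have : tsupport u ⊆ C := closure_minimal (fun x hx => by
    by_contra h
    exact hx (hs x h)) hC.isClosed
  exact ⟨hl, hC.of_isClosed_subset (isClosed_tsupport u) this, this.trans hCΩ, h0⟩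

lemma mono {Ω' : Set (EuclideanSpace ℝ (Fin N))} (h : Adm Ω u) (hs : Ω ⊆ Ω') : Adm Ω' u :=
  ⟨h.lip, h.cpt, h.sub.trans hs, h.nonneg⟩

/-- anything below an admissible function -/
lemma of_le (h : Adm Ω u) (hv : ∃ K : ℝ≥0, LipschitzWith K v) (h0 : ∀ x, 0 ≤ v x)
    (hle : ∀ x, v x ≤ u x) : Adm Ω v := by
  refine of_support hv h.cpt h.sub (fun x hx => ?_) h0
  have := image_eq_zero_of_notMem_tsupport hx
  exact le_antisymm (this ▸ hle x) (h0 x)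

lemma sup (ha : Adm Ω a) (hb : Adm Ω b) : Adm Ω (fun x => max (a x) (b x)) := by
  obtain ⟨K, hK⟩ := ha.lip
  obtain ⟨L, hL⟩ := hb.lip
  refine of_support ⟨max K L, hK.max hL⟩ (ha.cpt.isCompact.union hb.cpt.isCompact)
    (union_subset ha.sub hb.sub) (fun x hx => ?_) (fun x => le_max_of_le_left (ha.nonneg x))
  simp only [mem_union, not_or] at hx
  rw [image_eq_zero_of_notMem_tsupport hx.1, image_eq_zero_of_notMem_tsupport hx.2, max_self]

lemma inf (ha : Adm Ω a) (hb : Adm Ω b) : Adm Ω (fun x => min (a x) (b x)) := by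
  obtain ⟨K, hK⟩ := ha.lip
  obtain ⟨L, hL⟩ := hb.lip
  exact ha.of_le ⟨max K L, hK.min hL⟩ (fun x => le_min (ha.nonneg x) (hb.nonneg x))
    (fun x => min_le_left _ _)

lemma smul (ha : Adm Ω a) {t : ℝ} (ht : 0 ≤ t) : Adm Ω (fun x => t * a x) := by
  obtain ⟨K, hK⟩ := ha.lip
  refine of_support ⟨‖t‖₊ * K, ?_⟩ ha.cpt ha.sub (fun x hx => ?_)
    (fun x => mul_nonneg ht (ha.nonneg x))
  · exact (lipschitzWith_smul t).comp hK
  · rw [image_eq_zero_of_notMem_tsupport hx, mul_zero]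

lemma zero : Adm Ω (fun _ => (0 : ℝ)) :=
  of_support ⟨0, LipschitzWith.const 0⟩ isCompact_empty (empty_subset _) (fun _ _ => rfl)
    (fun _ => le_rfl)

end Adm

/-- pointwise modularity of the gradient -/
lemma grad_modular (p : ℝ) {x : EuclideanSpace ℝ (Fin N)} (ha : DifferentiableAt ℝ a x)
    (hb : DifferentiableAt ℝ b x) (hM : DifferentiableAt ℝ (fun x => max (a x) (b x)) x)
    (hm : DifferentiableAt ℝ (fun x => min (a x) (b x)) x) :
    ‖fderiv ℝ (fun x => max (a x) (b x)) x‖ ^ p + ‖fderiv ℝ (fun x => min (a x) (b x)) x‖ ^ p =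
      ‖fderiv ℝ a x‖ ^ p + ‖fderiv ℝ b x‖ ^ p := by
  have key : ∀ {f g : EuclideanSpace ℝ (Fin N) → ℝ}, DifferentiableAt ℝ f x →
      DifferentiableAt ℝ g x → (∀ᶠ y in 𝓝 x, g y ≤ f y) → f x = g x →
      fderiv ℝ f x = fderiv ℝ g x := by
    intro f g hf hg hle he
    have hmin : IsLocalMin (fun y => f y - g y) x := by
      filter_upwards [hle] with y hy
      linarith
    have := hmin.fderiv_eq_zero
    rw [fderiv_fun_sub hf hg] at this
    exact sub_eq_zero.1 this
  rcases lt_trichotomy (a x) (b x) with h | h | h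
  · have h' : ∀ᶠ y in 𝓝 x, a y < b y := ha.continuousAt.eventually_lt hb.continuousAt h
    have e1 : (fun x => max (a x) (b x)) =ᶠ[𝓝 x] b := h'.mono fun y hy => max_eq_right hy.le
    have e2 : (fun x => min (a x) (b x)) =ᶠ[𝓝 x] a := h'.mono fun y hy => min_eq_left hy.le
    rw [e1.fderiv_eq, e2.fderiv_eq, add_comm]
  · have e1 := key hM ha (Eventually.of_forall fun y => le_max_left _ _) (by simp [h])
    have e2 := key hM hb (Eventually.of_forall fun y => le_max_right _ _) (by simp [h])
    have e3 := key ha hm (Eventually.of_forall fun y => min_le_left _ _) (by simp [h])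
    rw [← e3, e1, ← e2, e1]
  · have h' : ∀ᶠ y in 𝓝 x, b y < a y := hb.continuousAt.eventually_lt ha.continuousAt h
    have e1 : (fun x => max (a x) (b x)) =ᶠ[𝓝 x] a := h'.mono fun y hy => max_eq_left hy.le
    have e2 : (fun x => min (a x) (b x)) =ᶠ[𝓝 x] b := h'.mono fun y hy => min_eq_right hy.le
    rw [e1.fderiv_eq, e2.fderiv_eq]

lemma En_modular {p : ℝ} (hp : 0 < p) (ha : Adm Ω a) (hb : Adm Ω b) :
    En p (fun x => max (a x) (b x)) + En p (fun x => min (a x) (b x)) = En p a + En p b := by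
  unfold En
  rw [← integral_add ((ha.sup hb).intE hp) ((ha.inf hb).intE hp),
    ← integral_add (ha.intE hp) (hb.intE hp)]
  apply integral_congr_ae
  filter_upwards [ha.ae_diff, hb.ae_diff, (ha.sup hb).ae_diff, (ha.inf hb).ae_diff]
    with x h1 h2 h3 h4
  exact grad_modular p h1 h2 h3 h4

lemma Qn_modular {p : ℝ} (hp : 0 < p) (ha : Adm Ω a) (hb : Adm Ω b) :
    Qn p (fun x => max (a x) (b x)) + Qn p (fun x => min (a x) (b x)) = Qn p a + Qn p b := by
  unfold Qn
  rw [← integral_add ((ha.sup hb).intQ hp) ((ha.inf hb).intQ hp),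
    ← integral_add (ha.intQ hp) (hb.intQ hp)]
  apply integral_congr_ae
  refine Eventually.of_forall fun x => ?_
  rcases le_total (a x) (b x) with h | h
  · simp only [max_eq_right h, min_eq_left h, add_comm]
  · simp only [max_eq_left h, min_eq_right h]

/-- approximate sub-minimizers of `J = q E - p Q`. -/
def SubMin (p q : ℝ) (Ω : Set (EuclideanSpace ℝ (Fin N))) (δ : ℝ)
    (u : EuclideanSpace ℝ (Fin N) → ℝ) : Prop :=
  ∀ v, Adm Ω v → (∀ x, v x ≤ u x) → q * En p u - p * Qn q u ≤ q * En p v - p * Qn q v + δ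

lemma SubMin.sup {p q δa δb : ℝ} (hp : 0 < p) (hq : 0 < q) (ha : Adm Ω a) (hb : Adm Ω b)
    (Sa : SubMin p q Ω δa a) (Sb : SubMin p q Ω δb b) :
    SubMin p q Ω (δa + δb) (fun x => max (a x) (b x)) := by
  intro v hv hle
  have hm' := hv.sup ha
  have e1 := En_modular hp hb hm'
  have e2 := Qn_modular hq hb hm'
  have e3 := En_modular hp hv ha
  have e4 := Qn_modular hq hv ha
  have hM : (fun x => max (b x) (max (v x) (a x))) = fun x => max (a x) (b x) := by
    funext x
    have := hle x
    apply le_antisymm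
    · exact max_le (le_max_right _ _) (max_le this (le_max_left _ _))
    · exact max_le ((le_max_right _ _).trans (le_max_right _ _)) (le_max_left _ _)
  rw [hM] at e1 e2
  have h1 := Sb _ (hb.inf hm') (fun x => min_le_left _ _)
  have h2 := Sa _ (hv.inf ha) (fun x => min_le_right _ _)
  have e1' := congrArg (q * ·) e1
  have e2' := congrArg (p * ·) e2
  have e3' := congrArg (q * ·) e3
  have e4' := congrArg (p * ·) e4
  simp only [mul_add] at e1' e2' e3' e4'
  linarith

lemma En_smul {p t : ℝ} (ht : 0 ≤ t) :
    En p (fun x => t * u x) = t ^ p * En p u := by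
  unfold En
  rw [← integral_const_mul]
  congr 1
  funext x
  have : fderiv ℝ (fun x => t * u x) x = t • fderiv ℝ u x :=
    congrFun (fderiv_const_smul_field (𝕜 := ℝ) t (f := u)) x
  rw [this, norm_smul, Real.norm_of_nonneg ht, Real.mul_rpow ht (norm_nonneg _)]

lemma Qn_smul {p t : ℝ} (ht : 0 ≤ t) (h : ∀ x, 0 ≤ u x) :
    Qn p (fun x => t * u x) = t ^ p * Qn p u := by
  unfold Qn
  rw [← integral_const_mul]
  congr 1
  funext x
  rw [Real.mul_rpow ht (h x)]

lemma SubMin.energy {p q δ t : ℝ} (hu : Adm Ω u) (S : SubMin p q Ω δ u)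
    (ht : 0 ≤ t) (ht1 : t ≤ 1) :
    q * (1 - t ^ p) * En p u ≤ p * (1 - t ^ q) * Qn q u + δ := by
  have := S _ (hu.smul ht) (fun x => by nlinarith [hu.nonneg x])
  rw [En_smul ht, Qn_smul ht hu.nonneg] at this
  linarith

lemma finset_sup {ι : Type*} {p q : ℝ} (hp : 0 < p) (hq : 0 < q) (s : Finset ι)
    (f : ι → EuclideanSpace ℝ (Fin N) → ℝ) (δ : ι → ℝ) (hf : ∀ i ∈ s, Adm Ω (f i))
    (hS : ∀ i ∈ s, SubMin p q Ω (δ i) (f i)) :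
    ∃ U, Adm Ω U ∧ SubMin p q Ω (∑ i ∈ s, δ i) U ∧ ∀ i ∈ s, ∀ x, f i x ≤ U x := by
  classical
  induction s using Finset.induction_on with
  | empty =>
    refine ⟨fun _ => 0, Adm.zero, ?_, by simp⟩
    intro v hv hle
    have : v = fun _ => 0 := funext fun x => le_antisymm (hle x) (hv.nonneg x)
    rw [this]; simp
  | insert i s hi ih =>
    obtain ⟨U, hU, SU, hle⟩ := ih (fun j hj => hf j (Finset.mem_insert_of_mem hj))
      (fun j hj => hS j (Finset.mem_insert_of_mem hj))
    have hi' := Finset.mem_insert_self i s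
    refine ⟨_, (hf i hi').sup hU, ?_, ?_⟩
    · rw [Finset.sum_insert hi]
      exact SubMin.sup hp hq (hf i hi') hU (hS i hi') SU
    · intro j hj x
      rcases Finset.mem_insert.1 hj with rfl | hj
      · exact le_max_left _ _
      · exact (hle j hj x).trans (le_max_right _ _)

end DistSumm

section DistSumm
open Filter Topology
open scoped NNReal ENNReal
variable {N : ℕ} {Ω : Set (EuclideanSpace ℝ (Fin N))} {u v a b : EuclideanSpace ℝ (Fin N) → ℝ}

lemma norm_gradient_eq (ψ : EuclideanSpace ℝ (Fin N) → ℝ) (x : EuclideanSpace ℝ (Fin N)) :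
    ‖gradient ψ x‖ = ‖fderiv ℝ ψ x‖ := by
  unfold gradient
  exact LinearIsometryEquiv.norm_map _ _

lemma setInt_grad {p : ℝ} (hp : 0 < p) (hs : tsupport u ⊆ Ω) :
    ∫ x in Ω, ‖gradient u x‖ ^ p = ∫ x, ‖fderiv ℝ u x‖ ^ p := by
  simp only [norm_gradient_eq]
  apply setIntegral_eq_integral_of_forall_compl_eq_zero
  intro x hx
  have : fderiv ℝ u x = 0 := by
    by_contra h
    exact hx (hs (support_fderiv_subset ℝ h))
  rw [this, norm_zero, Real.zero_rpow hp.ne']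

lemma setInt_pow {p : ℝ} (hp : 0 < p) (hs : tsupport u ⊆ Ω) :
    ∫ x in Ω, |u x| ^ p = ∫ x, |u x| ^ p := by
  apply setIntegral_eq_integral_of_forall_compl_eq_zero
  intro x hx
  have : u x = 0 := image_eq_zero_of_notMem_tsupport fun h => hx (hs h)
  rw [this, abs_zero, Real.zero_rpow hp.ne']

lemma lambda_le_smooth {p q : ℝ} (hp : 0 < p) (hq : 0 < q) (hu : ContDiff ℝ (⊤ : ℕ∞) u)
    (hc : HasCompactSupport u) (hs : tsupport u ⊆ Ω) :
    lambdaPQ p q Ω * (∫ x, |u x| ^ q) ^ (p / q) ≤ ∫ x, ‖fderiv ℝ u x‖ ^ p := by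
  set X := ∫ x, |u x| ^ q with hX
  have hX0 : 0 ≤ X := integral_nonneg fun x => by positivity
  rcases hX0.eq_or_lt with h0 | h0
  · rw [← h0, Real.zero_rpow (by positivity), mul_zero]
    exact integral_nonneg fun x => by positivity
  set c : ℝ := X ^ (-(1 / q)) with hcdef
  have hcpos : 0 < c := Real.rpow_pos_of_pos h0 _
  set w : EuclideanSpace ℝ (Fin N) → ℝ := fun x => c * u x with hw
  have hws : tsupport w ⊆ tsupport u := by
    apply closure_mono
    intro x hx h
    apply hx
    simp only [hw]
    rw [h, mul_zero]
  have e1 : ∫ x in Ω, |w x| ^ q = 1 := by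
    rw [setInt_pow hq (hws.trans hs)]
    simp only [hw, abs_mul, Real.mul_rpow (abs_nonneg _) (abs_nonneg _)]
    rw [integral_const_mul, ← hX, abs_of_pos hcpos, hcdef, ← Real.rpow_mul h0.le]
    rw [show -(1 / q) * q = -1 by field_simp, Real.rpow_neg_one]
    exact inv_mul_cancel₀ h0.ne'
  have e2 : ∫ x in Ω, ‖gradient w x‖ ^ p = c ^ p * ∫ x, ‖fderiv ℝ u x‖ ^ p := by
    rw [setInt_grad hp (hws.trans hs)]
    exact En_smul hcpos.le
  have hle : lambdaPQ p q Ω ≤ ∫ x in Ω, ‖gradient w x‖ ^ p := by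
    unfold lambdaPQ
    apply csInf_le
    · refine ⟨0, ?_⟩
      rintro E ⟨ψ, -, -, -, -, rfl⟩
      exact integral_nonneg fun x => by positivity
    · exact ⟨w, contDiff_const.mul hu, hc.mul_left, hws.trans hs, e1, rfl⟩
  rw [e2] at hle
  have hcp : c ^ p * X ^ (p / q) = 1 := by
    rw [hcdef, ← Real.rpow_mul h0.le, ← Real.rpow_add h0]
    rw [show -(1 / q) * p + p / q = 0 by ring, Real.rpow_zero]
  have hXp : 0 ≤ X ^ (p / q) := by positivity
  calc lambdaPQ p q Ω * X ^ (p / q)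
      ≤ (c ^ p * ∫ x, ‖fderiv ℝ u x‖ ^ p) * X ^ (p / q) := by gcongr
    _ = (c ^ p * X ^ (p / q)) * ∫ x, ‖fderiv ℝ u x‖ ^ p := by ring
    _ = _ := by rw [hcp, one_mul]

open ContinuousLinearMap in
lemma fderiv_mollify (φ : ContDiffBump (0 : EuclideanSpace ℝ (Fin N))) {K : ℝ≥0}
    (hL : LipschitzWith K u) (x : EuclideanSpace ℝ (Fin N)) :
    fderiv ℝ (convolution (φ.normed volume) u (lsmul ℝ ℝ) volume) x
      = convolution (φ.normed volume) (fderiv ℝ u) (lsmul ℝ ℝ) volume x := by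
  have hφi : Integrable (φ.normed volume) := φ.integrable_normed
  have hφc : Continuous (φ.normed volume) := φ.continuous_normed
  have hmeas : AEStronglyMeasurable
      (fun t => φ.normed volume t • fderiv ℝ u (x - t)) volume := by
    apply AEStronglyMeasurable.smul hφc.aestronglyMeasurable
    have : Measurable (fun t => fderiv ℝ u (x - t)) :=
      (measurable_fderiv ℝ u).comp (measurable_const.sub measurable_id)
    exact this.aestronglyMeasurable
  have hd : ∀ᵐ t, DifferentiableAt ℝ u (x - t) :=
    (Measure.measurePreserving_sub_left volume x).quasiMeasurePreserving.ae
      hL.ae_differentiableAt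
  have := hasFDerivAt_integral_of_dominated_loc_of_lip (𝕜 := ℝ) (μ := volume)
    (F := fun y t => φ.normed volume t • u (y - t))
    (F' := fun t => φ.normed volume t • fderiv ℝ u (x - t))
    (bound := fun t => φ.normed volume t * K) (s := univ) (x₀ := x)
    univ_mem ?_ ?_ hmeas ?_ (hφi.mul_const _) ?_
  · exact this.2.fderiv
  · exact Eventually.of_forall fun y => (hφc.smul (hL.continuous.comp
      (continuous_const.sub continuous_id))).aestronglyMeasurable
  · exact (hφc.smul (hL.continuous.comp
      (continuous_const.sub continuous_id))).integrable_of_hasCompactSupport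
      (φ.hasCompactSupport_normed.smul_right)
  · refine Eventually.of_forall fun t => LipschitzOnWith.of_dist_le_mul fun y _ z _ => ?_
    have h0 := φ.nonneg_normed (μ := volume) t
    rw [dist_eq_norm, ← smul_sub, norm_smul, Real.norm_of_nonneg h0]
    have := hL.dist_le_mul (y - t) (z - t)
    rw [dist_sub_right, dist_eq_norm] at this
    simp only [Real.coe_nnabs]
    rw [abs_of_nonneg (by positivity), mul_assoc]
    gcongr
  · filter_upwards [hd] with t ht
    have h1 : HasFDerivAt (fun y => u (y - t)) (fderiv ℝ u (x - t)) x := by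
      have h2 := (ht.hasFDerivAt).comp x ((hasFDerivAt_id x).sub_const t)
      rw [ContinuousLinearMap.comp_id] at h2
      exact h2
    exact h1.const_smul (φ.normed volume t)

open ContinuousLinearMap in
lemma lambda_le {p q : ℝ} (hp : 0 < p) (hq : 0 < q) (hΩ : IsOpen Ω) (hu : Adm Ω u) :
    lambdaPQ p q Ω * Qn q u ^ (p / q) ≤ En p u := by
  obtain ⟨K, hK⟩ := hu.lip
  obtain ⟨δ, hδ, hsub⟩ := hu.cpt.isCompact.exists_cthickening_subset_open hΩ hu.sub
  set C := cthickening δ (tsupport u) with hC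
  have hCc : IsCompact C := hu.cpt.isCompact.cthickening
  let φ : ℕ → ContDiffBump (0 : EuclideanSpace ℝ (Fin N)) := fun n =>
    { rIn := δ / (2 * (n + 1)), rOut := δ / (n + 1), rIn_pos := by positivity,
      rIn_lt_rOut := by
        apply div_lt_div_of_pos_left hδ (by positivity)
        linarith [(by positivity : (0 : ℝ) < n + 1)] }
  have hr : ∀ n, (φ n).rOut = δ / (n + 1) := fun n => rfl
  have hrle : ∀ n, (φ n).rOut ≤ δ := fun n => by
    rw [hr]; apply div_le_self hδ.le; linarith [(Nat.cast_nonneg n : (0 : ℝ) ≤ n)]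
  have hr0 : Tendsto (fun n => (φ n).rOut) atTop (𝓝 0) := by
    have := tendsto_one_div_add_atTop_nhds_zero_nat (𝕜 := ℝ)
    have := this.const_mul δ
    rw [mul_zero] at this
    refine this.congr fun n => ?_
    rw [hr]; ring
  have hrr : ∀ᶠ n in atTop, (φ n).rOut ≤ 2 * (φ n).rIn := Eventually.of_forall fun n => by
    change δ / (n + 1) ≤ 2 * (δ / (2 * (n + 1)))
    apply le_of_eq; field_simp
  let w : ℕ → EuclideanSpace ℝ (Fin N) → ℝ := fun n =>
    convolution ((φ n).normed volume) u (lsmul ℝ ℝ) volume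
  have hwsm : ∀ n, ContDiff ℝ (⊤ : ℕ∞) (w n) := fun n =>
    (φ n).hasCompactSupport_normed.contDiff_convolution_left _ (φ n).contDiff_normed
      hu.continuous.locallyIntegrable
  have hws : ∀ n x, x ∉ C → w n x = 0 := by
    intro n x hx
    by_contra h
    apply hx
    have := support_convolution_subset (lsmul ℝ ℝ) (f := (φ n).normed volume) (g := u)
      (μ := volume) h
    obtain ⟨y, hy, z, hz, rfl⟩ := this
    rw [(φ n).support_normed_eq, mem_ball_zero_iff] at hy
    apply mem_cthickening_of_dist_le _ z _ _ (subset_tsupport _ hz)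
    simpa [dist_eq_norm] using hy.le.trans (hrle n)
  have hwt : ∀ n, tsupport (w n) ⊆ C := fun n => closure_minimal (fun x hx => by
    by_contra h; exact hx (hws n x h)) isClosed_cthickening
  have hwc : ∀ n, HasCompactSupport (w n) := fun n =>
    hCc.of_isClosed_subset (isClosed_tsupport _) (hwt n)
  have hfd : ∀ n x, fderiv ℝ (w n) x =
      convolution ((φ n).normed volume) (fderiv ℝ u) (lsmul ℝ ℝ) volume x :=
    fun n x => fderiv_mollify (φ n) hK x
  have hmf : AEStronglyMeasurable (fderiv ℝ u) volume :=
    (measurable_fderiv ℝ u).aestronglyMeasurable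
  have hfn : ∀ x, ‖fderiv ℝ u x‖ ≤ K := fun x => norm_fderiv_le_of_lipschitz ℝ hK
  have hbd : ∀ n x, ‖fderiv ℝ (w n) x‖ ≤ 3 * K := by
    intro n x
    have := (φ n).dist_normed_convolution_le (x₀ := x) (ε := 2 * (K : ℝ)) hmf (fun y _ => by
      rw [dist_eq_norm]
      exact (norm_sub_le _ _).trans (by linarith [hfn x, hfn y]))
    rw [← hfd, dist_eq_norm] at this
    calc ‖fderiv ℝ (w n) x‖ = ‖(fderiv ℝ (w n) x - fderiv ℝ u x) + fderiv ℝ u x‖ := by simp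
      _ ≤ _ := norm_add_le _ _
      _ ≤ 3 * K := by linarith [hfn x]
  obtain ⟨B, hB⟩ := hu.cpt.exists_bound_of_continuous hu.continuous
  have hwb : ∀ n x, |w n x| ≤ B + K * δ := by
    intro n x
    have := (φ n).dist_normed_convolution_le (μ := volume) (x₀ := x) (ε := (K : ℝ) * δ)
      hu.continuous.aestronglyMeasurable (fun y hy => by
      refine (hK.dist_le_mul y x).trans ?_
      gcongr
      exact (mem_ball.1 hy).le.trans (hrle n))
    rw [dist_eq_norm] at this
    have h3 := hB x
    rw [Real.norm_eq_abs] at this h3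
    have h4 : |w n x| ≤ |w n x - u x| + |u x| := by
      simpa using abs_add_le (w n x - u x) (u x)
    exact h4.trans (by linarith [this])
  have hind : ∀ c : ℝ, Integrable (C.indicator fun _ => c) (volume : Measure (EuclideanSpace ℝ (Fin N))) := by
    intro c
    rw [integrable_indicator_iff hCc.measurableSet]
    exact integrableOn_const hCc.measure_lt_top.ne
  have lim1 : Tendsto (fun n => ∫ x, |w n x| ^ q) atTop (𝓝 (∫ x, |u x| ^ q)) := by
    refine tendsto_integral_of_dominated_convergence (C.indicator fun _ => (B + K * δ) ^ q)
      (fun n => ?_) (hind _) (fun n => Eventually.of_forall fun x => ?_)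
      (Eventually.of_forall fun x => ?_)
    · exact ((hwsm n).continuous.abs.rpow_const fun _ => Or.inr hq.le).aestronglyMeasurable
    · by_cases hx : x ∈ C
      · rw [indicator_of_mem hx, Real.norm_of_nonneg (by positivity)]
        exact Real.rpow_le_rpow (abs_nonneg _) (hwb n x) hq.le
      · rw [indicator_of_notMem hx, hws n x hx, abs_zero, Real.zero_rpow hq.ne', norm_zero]
    · have := ContDiffBump.convolution_tendsto_right_of_continuous (μ := volume) hr0
        hu.continuous x
      exact (this.abs).rpow_const (Or.inr hq.le)
  have lim2 : Tendsto (fun n => ∫ x, ‖fderiv ℝ (w n) x‖ ^ p) atTop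
      (𝓝 (∫ x, ‖fderiv ℝ u x‖ ^ p)) := by
    have hli : LocallyIntegrable (fderiv ℝ u) volume := by
      refine (locallyIntegrable_const (K : ℝ)).mono hmf (Eventually.of_forall fun x => ?_)
      simpa using hfn x
    refine tendsto_integral_of_dominated_convergence (C.indicator fun _ => (3 * (K : ℝ)) ^ p)
      (fun n => ?_) (hind _) (fun n => Eventually.of_forall fun x => ?_) ?_
    · exact (((measurable_fderiv ℝ (w n)).norm).pow_const p).aestronglyMeasurable
    · rw [Real.norm_of_nonneg (by positivity)]
      by_cases hx : x ∈ C
      · rw [indicator_of_mem hx]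
        exact Real.rpow_le_rpow (norm_nonneg _) (hbd n x) hp.le
      · have : fderiv ℝ (w n) x = 0 := by
          by_contra h
          exact hx (hwt n (support_fderiv_subset ℝ h))
        rw [indicator_of_notMem hx, this, norm_zero, Real.zero_rpow hp.ne']
    · filter_upwards [ContDiffBump.ae_convolution_tendsto_right_of_locallyIntegrable
        (μ := volume) hr0 hrr hli] with x hx
      simp only [hfd]
      exact hx.norm.rpow_const (Or.inr hp.le)
  have hQ : Qn q u = ∫ x, |u x| ^ q := by
    unfold Qn; simp only [abs_of_nonneg (hu.nonneg _)]
  rw [hQ]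
  refine le_of_tendsto_of_tendsto' ((lim1.rpow_const (Or.inr (by positivity))).const_mul _) lim2
    fun n => ?_
  exact lambda_le_smooth hp hq (hwsm n) (hwc n) ((hwt n).trans hsub)

end DistSumm

section DistSumm
open Filter Topology
open scoped NNReal ENNReal
variable {N : ℕ} {Ω : Set (EuclideanSpace ℝ (Fin N))} {u v a b : EuclideanSpace ℝ (Fin N) → ℝ}

lemma int_scale (g : EuclideanSpace ℝ (Fin N) → ℝ) {d : ℝ} (hd : 0 < d)
    (x : EuclideanSpace ℝ (Fin N)) :
    ∫ y, g (d⁻¹ • (y - x)) = d ^ N * ∫ y, g y := by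
  rw [integral_sub_right_eq_self (fun y => g (d⁻¹ • y)) x,
    Measure.integral_comp_inv_smul_of_nonneg _ _ hd.le, finrank_euclideanSpace_fin, smul_eq_mul]

lemma Qn_scale {s A d : ℝ} (hA : 0 ≤ A) (hd : 0 < d) (h0 : ∀ x, 0 ≤ u x)
    (x : EuclideanSpace ℝ (Fin N)) :
    Qn s (fun y => A * u (d⁻¹ • (y - x))) = A ^ s * (d ^ N * Qn s u) := by
  rw [Qn_smul hA (fun y => h0 _)]
  unfold Qn
  rw [int_scale (fun y => u y ^ s) hd x]

lemma En_scale {p A d : ℝ} (hA : 0 ≤ A) (hd : 0 < d)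
    (x : EuclideanSpace ℝ (Fin N)) :
    En p (fun y => A * u (d⁻¹ • (y - x))) = A ^ p * (d⁻¹ ^ p * (d ^ N * En p u)) := by
  rw [En_smul hA]
  unfold En
  rw [← int_scale (fun y => ‖fderiv ℝ u y‖ ^ p) hd x, ← integral_const_mul (d⁻¹ ^ p)]
  congr 2
  funext y
  rw [fderiv_comp_sub (f := fun z => u (d⁻¹ • z)), fderiv_comp_smul, norm_smul,
    Real.norm_of_nonneg (inv_pos.2 hd).le,
    Real.mul_rpow (inv_pos.2 hd).le (norm_nonneg _)]

lemma Adm.scale (h : Adm Ω u) {A d : ℝ} (hA : 0 ≤ A) (hd : 0 < d)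
    (x : EuclideanSpace ℝ (Fin N)) :
    Adm ((fun y => d⁻¹ • (y - x)) ⁻¹' Ω) (fun y => A * u (d⁻¹ • (y - x))) := by
  obtain ⟨K, hK⟩ := h.lip
  refine Adm.smul (a := fun y => u (d⁻¹ • (y - x))) ?_ hA
  refine Adm.of_support (C := (fun y => x + d • y) '' tsupport u) ⟨K * (‖d⁻¹‖₊ * (1 + 0)), ?_⟩ ?_ ?_ ?_ ?_
  · exact hK.comp ((lipschitzWith_smul d⁻¹).comp (LipschitzWith.id.sub (LipschitzWith.const x)))
  · exact h.cpt.isCompact.image (by fun_prop)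
  · rintro _ ⟨y, hy, rfl⟩
    simpa [smul_smul, inv_mul_cancel₀ hd.ne'] using h.sub hy
  · intro y hy
    apply image_eq_zero_of_notMem_tsupport
    intro hy'
    apply hy
    exact ⟨_, hy', by simp [smul_smul, mul_inv_cancel₀ hd.ne']⟩
  · exact fun y => h.nonneg _

lemma Adm.scale_ball (h : Adm (ball 0 1) u) {A d : ℝ} (hA : 0 ≤ A) (hd : 0 < d)
    (x : EuclideanSpace ℝ (Fin N)) :
    Adm (ball x d) (fun y => A * u (d⁻¹ • (y - x))) := by
  refine (h.scale hA hd x).mono fun y hy => ?_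
  simp only [mem_preimage, mem_ball_zero_iff, norm_smul, norm_inv, Real.norm_of_nonneg hd.le] at hy
  rw [mem_ball, dist_eq_norm]
  rwa [inv_mul_lt_iff₀ hd, mul_one] at hy

lemma ball_ineq {p d : ℝ} (hp : 0 < p) (hd : 0 < d) {x : EuclideanSpace ℝ (Fin N)}
    (h : Adm (ball x d) u) :
    lambdaPQ p p (ball (0 : EuclideanSpace ℝ (Fin N)) 1) * d⁻¹ ^ p * Qn p u ≤ En p u := by
  have hd' := inv_pos.2 hd
  set x' := -(d⁻¹ • x) with hx'
  have hw := h.scale zero_le_one hd' x'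
  have hT : ∀ y, d⁻¹⁻¹ • (y - x') = d • y + x := by
    intro y
    rw [inv_inv, hx', sub_neg_eq_add, smul_add, smul_smul, mul_inv_cancel₀ hd.ne', one_smul]
  have hw' : Adm (ball 0 1) (fun y => 1 * u (d⁻¹⁻¹ • (y - x'))) := by
    refine hw.mono fun y hy => ?_
    simp only [mem_preimage, hT, mem_ball, dist_eq_norm, add_sub_cancel_right, norm_smul,
      Real.norm_of_nonneg hd.le] at hy
    rw [mem_ball_zero_iff]
    by_contra hc
    push Not at hc
    nlinarith
  have := lambda_le hp hp isOpen_ball hw'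
  rw [div_self hp.ne', Real.rpow_one, En_scale zero_le_one hd', Qn_scale zero_le_one hd' h.nonneg,
    Real.one_rpow, one_mul, one_mul, inv_inv] at this
  have hdN : 0 < d⁻¹ ^ N := by positivity
  have hdp : 0 < d⁻¹ ^ p := Real.rpow_pos_of_pos hd' _
  have hdd : d⁻¹ ^ p * d ^ p = 1 := by
    rw [← Real.mul_rpow hd'.le hd.le, inv_mul_cancel₀ hd.ne', Real.one_rpow]
  have h3 : d⁻¹ ^ N * (lambdaPQ p p (ball (0 : EuclideanSpace ℝ (Fin N)) 1) * Qn p u) ≤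
      d⁻¹ ^ N * (d ^ p * En p u) := by linarith
  have h4 := le_of_mul_le_mul_left h3 hdN
  calc _ = d⁻¹ ^ p * (lambdaPQ p p (ball (0 : EuclideanSpace ℝ (Fin N)) 1) * Qn p u) := by ring
    _ ≤ d⁻¹ ^ p * (d ^ p * En p u) := by gcongr
    _ = (d⁻¹ ^ p * d ^ p) * En p u := by ring
    _ = _ := by rw [hdd, one_mul]

lemma young_simple {p s t : ℝ} (hp : 1 < p) (hs : 0 ≤ s) (ht : 0 ≤ t) :
    p * s ^ (p - 1) * t ≤ 1 / 2 * s ^ p + p * (2 * p) ^ (p - 1) * t ^ p := by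
  have hsp : s ^ p = s ^ (p - 1) * s := by
    rw [← Real.rpow_add_one' hs (by linarith)]; congr 1; ring
  have htp : t ^ p = t ^ (p - 1) * t := by
    rw [← Real.rpow_add_one' ht (by linarith)]; congr 1; ring
  have h1 : 0 ≤ s ^ (p - 1) := by positivity
  have h2 : 0 ≤ t ^ (p - 1) := by positivity
  rcases le_total (2 * p * t) s with h | h
  · have : 0 ≤ p * (2 * p) ^ (p - 1) * t ^ p := by positivity
    rw [hsp]
    nlinarith [mul_le_mul_of_nonneg_left h h1]
  · have h3 : s ^ (p - 1) ≤ (2 * p) ^ (p - 1) * t ^ (p - 1) := by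
      rw [← Real.mul_rpow (by positivity) ht]
      exact Real.rpow_le_rpow hs h (by linarith)
    have h4 : 0 ≤ s ^ p := by positivity
    rw [htp]
    calc p * s ^ (p - 1) * t ≤ p * ((2 * p) ^ (p - 1) * t ^ (p - 1)) * t := by gcongr
      _ ≤ _ := by nlinarith

lemma poincare {p : ℝ} (hN : 0 < N) (hp : 1 < p) (hu : ContDiff ℝ (⊤ : ℕ∞) u)
    (hc : HasCompactSupport u) (hs : tsupport u ⊆ ball 0 1) :
    ∫ x, |u x| ^ p ≤ 2 * (p * (2 * p) ^ (p - 1)) * ∫ x, ‖fderiv ℝ u x‖ ^ p := by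
  have hp0 : 0 < p := by linarith
  let i : Fin N := ⟨0, hN⟩
  let e : EuclideanSpace ℝ (Fin N) := EuclideanSpace.single i 1
  let f : EuclideanSpace ℝ (Fin N) → ℝ := fun x => x i
  have hff : ∀ x, HasFDerivAt f (EuclideanSpace.proj i : EuclideanSpace ℝ (Fin N) →L[ℝ] ℝ) x :=
    fun x => (EuclideanSpace.proj i : EuclideanSpace ℝ (Fin N) →L[ℝ] ℝ).hasFDerivAt
  have hfe : ∀ x, fderiv ℝ f x e = 1 := by
    intro x
    rw [(hff x).fderiv]
    simp [e]
  have hud : Differentiable ℝ u := hu.differentiable (by simp)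
  let g : EuclideanSpace ℝ (Fin N) → ℝ := fun x => |u x| ^ p
  have hg : ∀ x, HasFDerivAt g ((p * |u x| ^ (p - 2) * u x) • fderiv ℝ u x) x := fun x =>
    (hasDerivAt_abs_rpow (u x) hp).comp_hasFDerivAt x (hud x).hasFDerivAt
  have hgc : Continuous g := hud.continuous.abs.rpow_const fun _ => Or.inr hp0.le
  have hgs : ∀ x, x ∉ tsupport u → g x = 0 := fun x hx => by
    simp only [g]
    rw [image_eq_zero_of_notMem_tsupport hx, abs_zero, Real.zero_rpow hp0.ne']
  have hgi : Integrable g := cont_pow_integrable hp0 hud.continuous hc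
  obtain ⟨K, hK⟩ := hu.lipschitzWith_of_hasCompactSupport hc (by simp)
  have hEi : Integrable fun x => ‖fderiv ℝ u x‖ ^ p := lip_grad_integrable hp0 hK hc
  have hb : ∀ x, ‖f x * fderiv ℝ g x e‖ ≤
      1 / 2 * |u x| ^ p + p * (2 * p) ^ (p - 1) * ‖fderiv ℝ u x‖ ^ p := by
    intro x
    by_cases hx : x ∈ tsupport u
    · refine le_trans ?_ (young_simple hp (abs_nonneg _) (norm_nonneg _))
      have hx1 : ‖x‖ ≤ 1 := (mem_ball_zero_iff.1 (hs hx)).le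
      have hfx : ‖f x‖ ≤ 1 := (PiLp.norm_apply_le x i).trans hx1
      rw [(hg x).fderiv, norm_mul]
      have he : ‖fderiv ℝ u x e‖ ≤ ‖fderiv ℝ u x‖ := by
        have := (fderiv ℝ u x).le_opNorm e
        simpa [e] using this
      have hm : ‖p * |u x| ^ (p - 2) * u x‖ = p * |u x| ^ (p - 1) := by
        rw [norm_mul, norm_mul, Real.norm_of_nonneg hp0.le, Real.norm_of_nonneg (by positivity),
          Real.norm_eq_abs, mul_assoc, ← Real.rpow_add_one' (abs_nonneg _) (by linarith)]
        congr 2; ring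
      rw [ContinuousLinearMap.smul_apply, norm_smul, hm]
      calc ‖f x‖ * (p * |u x| ^ (p - 1) * ‖fderiv ℝ u x e‖)
          ≤ 1 * (p * |u x| ^ (p - 1) * ‖fderiv ℝ u x‖) := by gcongr
        _ = _ := one_mul _
    · have : u x = 0 := image_eq_zero_of_notMem_tsupport hx
      rw [(hg x).fderiv, this]
      simp only [mul_zero, zero_smul, ContinuousLinearMap.zero_apply, norm_zero]
      positivity
  have hmaj : Integrable fun x =>
      1 / 2 * |u x| ^ p + p * (2 * p) ^ (p - 1) * ‖fderiv ℝ u x‖ ^ p :=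
    (hgi.const_mul _).add (hEi.const_mul _)
  have hfc : Continuous f := (EuclideanSpace.proj i : EuclideanSpace ℝ (Fin N) →L[ℝ] ℝ).continuous
  have hi2 : Integrable (fun x => f x * fderiv ℝ g x e) := by
    refine hmaj.mono' ?_ (Eventually.of_forall hb)
    exact (hfc.measurable.mul (measurable_fderiv_apply_const ℝ g e)).aestronglyMeasurable
  have hi3 : Integrable (fun x => f x * g x) := by
    apply (hfc.mul hgc).integrable_of_hasCompactSupport
    refine hc.mono' fun x hx => ?_
    by_contra h
    apply hx
    simp [hgs x h]
  have ibp := integral_mul_fderiv_eq_neg_fderiv_mul_of_integrable (μ := volume) (f := f) (g := g)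
    (v := e) (by simpa only [hfe, one_mul] using hgi) hi2 hi3
    (fun x _ => (hff x).differentiableAt) (fun x _ => (hg x).differentiableAt)
  simp only [hfe, one_mul] at ibp
  have h1 : ∫ x, g x ≤ ∫ x, (1 / 2 * |u x| ^ p + p * (2 * p) ^ (p - 1) * ‖fderiv ℝ u x‖ ^ p) := by
    calc ∫ x, g x = -∫ x, f x * fderiv ℝ g x e := by rw [ibp, neg_neg]
      _ ≤ ‖∫ x, f x * fderiv ℝ g x e‖ := neg_le_abs _
      _ ≤ _ := norm_integral_le_of_norm_le hmaj (Eventually.of_forall hb)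
  rw [integral_add (hgi.const_mul _) (hEi.const_mul _), integral_const_mul,
    integral_const_mul] at h1
  simp only [g] at h1
  linarith

lemma exists_test (hN : 0 < N) {p ε : ℝ} (hp : 1 < p) (hε : 0 < ε) :
    ∃ ψ : EuclideanSpace ℝ (Fin N) → ℝ, ContDiff ℝ (⊤ : ℕ∞) ψ ∧
    HasCompactSupport ψ ∧ tsupport ψ ⊆ ball 0 1 ∧ (∫ x, |ψ x| ^ p) = 1 ∧
    ∫ x, ‖fderiv ℝ ψ x‖ ^ p < lambdaPQ p p (ball (0 : EuclideanSpace ℝ (Fin N)) 1) + ε := by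
  have hp0 : 0 < p := by linarith
  have hne : {E : ℝ | ∃ ψ : EuclideanSpace ℝ (Fin N) → ℝ, ContDiff ℝ (⊤ : ℕ∞) ψ ∧
    HasCompactSupport ψ ∧ tsupport ψ ⊆ ball 0 1 ∧
    (∫ x in ball 0 1, |ψ x| ^ p) = 1 ∧
    E = ∫ x in ball 0 1, ‖gradient ψ x‖ ^ p}.Nonempty := by
    let φ : ContDiffBump (0 : EuclideanSpace ℝ (Fin N)) :=
      { rIn := 1 / 4, rOut := 1 / 2, rIn_pos := by norm_num, rIn_lt_rOut := by norm_num }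
    have hφs : tsupport φ ⊆ ball 0 1 := by
      rw [φ.tsupport_eq]
      exact closedBall_subset_ball (by change (1 / 2 : ℝ) < 1; norm_num)
    have hi := cont_pow_integrable hp0 φ.continuous φ.hasCompactSupport
    have hX : 0 < ∫ x, |φ x| ^ p := by
      rw [integral_pos_iff_support_of_nonneg (fun x => by positivity) hi]
      have : ball (0 : EuclideanSpace ℝ (Fin N)) (1 / 2) ⊆
          Function.support fun x => |φ x| ^ p := by
        intro x hx
        have : 0 < φ x := φ.pos_of_mem_ball hx
        exact (Real.rpow_pos_of_pos (abs_pos.2 this.ne') _).ne'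
      exact (measure_ball_pos volume _ (by norm_num)).trans_le (measure_mono this)
    set X := ∫ x, |φ x| ^ p
    set c : ℝ := X ^ (-(1 / p)) with hcdef
    have hcpos : 0 < c := Real.rpow_pos_of_pos hX _
    have hws : tsupport (fun x => c * φ x) ⊆ tsupport φ := by
      apply closure_mono
      intro x hx h
      apply hx
      simp only [h, mul_zero]
    refine ⟨_, fun x => c * φ x, contDiff_const.mul φ.contDiff, φ.hasCompactSupport.mul_left,
      hws.trans hφs, ?_, rfl⟩
    rw [setInt_pow hp0 (hws.trans hφs)]
    simp only [abs_mul, Real.mul_rpow (abs_nonneg _) (abs_nonneg _)]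
    rw [integral_const_mul, abs_of_pos hcpos, hcdef, ← Real.rpow_mul hX.le]
    rw [show -(1 / p) * p = -1 by field_simp, Real.rpow_neg_one]
    exact inv_mul_cancel₀ hX.ne'
  obtain ⟨E, ⟨ψ, h1, h2, h3, h4, rfl⟩, hE⟩ := exists_lt_of_csInf_lt hne
    (lt_add_of_pos_right (lambdaPQ p p (ball (0 : EuclideanSpace ℝ (Fin N)) 1)) hε)
  rw [setInt_pow hp0 h3] at h4
  rw [setInt_grad hp0 h3] at hE
  exact ⟨ψ, h1, h2, h3, h4, hE⟩

lemma lambda_ball_pos (hN : 0 < N) {p : ℝ} (hp : 1 < p) :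
    0 < lambdaPQ p p (ball (0 : EuclideanSpace ℝ (Fin N)) 1) := by
  have hC : 0 < 2 * (p * (2 * p) ^ (p - 1)) := by positivity
  set C := 2 * (p * (2 * p) ^ (p - 1)) with hCdef
  have : C⁻¹ ≤ lambdaPQ p p (ball (0 : EuclideanSpace ℝ (Fin N)) 1) := by
    refine le_of_forall_pos_le_add fun ε hε => ?_
    obtain ⟨ψ, h1, h2, h3, h4, h5⟩ := exists_test hN hp hε
    have := poincare hN hp h1 h2 h3
    rw [h4, ← hCdef] at this
    refine le_trans ?_ h5.le
    rwa [inv_eq_one_div, div_le_iff₀' hC]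
  exact (inv_pos.2 hC).trans_le this

end DistSumm

section DistSumm
open Filter Topology
open scoped NNReal ENNReal
variable {N : ℕ} {Ω : Set (EuclideanSpace ℝ (Fin N))} {u v a b : EuclideanSpace ℝ (Fin N) → ℝ}

lemma polar_int (hN : 0 < N) (h : EuclideanSpace ℝ (Fin N) → ℝ) (hi : Integrable h) :
    Integrable (fun z : sphere (0 : EuclideanSpace ℝ (Fin N)) 1 × Ioi (0 : ℝ) =>
      h (z.2.1 • z.1.1)) ((volume : Measure (EuclideanSpace ℝ (Fin N))).toSphere.prod
        (.volumeIoiPow (Module.finrank ℝ (EuclideanSpace ℝ (Fin N)) - 1))) ∧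
    ∫ x, h x = ∫ z : sphere (0 : EuclideanSpace ℝ (Fin N)) 1 × Ioi (0 : ℝ),
      h (z.2.1 • z.1.1) ∂((volume : Measure (EuclideanSpace ℝ (Fin N))).toSphere.prod
        (.volumeIoiPow (Module.finrank ℝ (EuclideanSpace ℝ (Fin N)) - 1))) := by
  have : Nonempty (Fin N) := ⟨⟨0, hN⟩⟩
  have : Nontrivial (EuclideanSpace ℝ (Fin N)) := inferInstance
  have key : ∀ x : ({(0)}ᶜ : Set (EuclideanSpace ℝ (Fin N))),
      h ((homeomorphUnitSphereProd (EuclideanSpace ℝ (Fin N)) x).2.1 •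
        (homeomorphUnitSphereProd (EuclideanSpace ℝ (Fin N)) x).1.1) = h x.1 := by
    intro x
    have hx : ‖x.1‖ ≠ 0 := norm_ne_zero_iff.2 x.2
    congr 1
    simp [smul_smul, mul_inv_cancel₀ hx]
  have mp := (volume : Measure (EuclideanSpace ℝ (Fin N))).measurePreserving_homeomorphUnitSphereProd
  constructor
  · rw [← mp.integrable_comp_emb (Homeomorph.measurableEmbedding _)]
    simp only [Function.comp_def, key]
    have := (integrableOn_iff_comap_subtypeVal (f := h) (μ := volume)
      (measurableSet_singleton (0 : EuclideanSpace ℝ (Fin N))).compl).1 hi.integrableOn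
    exact this
  · rw [← mp.integral_comp (Homeomorph.measurableEmbedding _)]
    simp only [key]
    rw [integral_subtype_comap (measurableSet_singleton _).compl fun x ↦ h x,
        restrict_compl_singleton]

lemma polar_exists (hN : 0 < N) (h : EuclideanSpace ℝ (Fin N) → ℝ) (hc : Continuous h) {R : ℝ}
    (hR : ∀ x, R ≤ ‖x‖ → h x = 0) (hpos : 0 < ∫ x, h x) :
    ∃ θ : EuclideanSpace ℝ (Fin N), ‖θ‖ = 1 ∧ Integrable (fun x : EuclideanSpace ℝ (Fin N) => h (‖x‖ • θ)) ∧
      0 < ∫ x : EuclideanSpace ℝ (Fin N), h (‖x‖ • θ) := by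
  have : Nonempty (Fin N) := ⟨⟨0, hN⟩⟩
  have : Nontrivial (EuclideanSpace ℝ (Fin N)) := inferInstance
  have cs : ∀ f : EuclideanSpace ℝ (Fin N) → ℝ, Continuous f → (∀ x, R ≤ ‖x‖ → f x = 0) →
      Integrable f := by
    intro f hf hf0
    refine hf.integrable_of_hasCompactSupport (HasCompactSupport.intro
      (isCompact_closedBall (0 : EuclideanSpace ℝ (Fin N)) R) fun x hx => hf0 x ?_)
    simp only [mem_closedBall, dist_zero_right, not_le] at hx
    exact hx.le
  obtain ⟨i1, e1⟩ := polar_int hN h (cs h hc hR)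
  rw [e1, integral_prod _ i1] at hpos
  have : ∃ θ : sphere (0 : EuclideanSpace ℝ (Fin N)) 1, 0 < ∫ r : Ioi (0 : ℝ), h (r.1 • θ.1)
      ∂(Measure.volumeIoiPow (Module.finrank ℝ (EuclideanSpace ℝ (Fin N)) - 1)) := by
    by_contra hcon
    push Not at hcon
    exact absurd (integral_nonpos (fun θ => hcon θ)) (not_le.2 hpos)
  obtain ⟨θ, hθ⟩ := this
  have hθ1 : ‖θ.1‖ = 1 := by simpa using θ.2
  have i2 : Integrable (fun x : EuclideanSpace ℝ (Fin N) => h (‖x‖ • θ.1)) := by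
    apply cs
    · exact hc.comp (continuous_norm.smul continuous_const)
    · intro x hx
      apply hR
      rwa [norm_smul, norm_norm, hθ1, mul_one]
  refine ⟨θ.1, hθ1, i2, ?_⟩
  obtain ⟨i3, e3⟩ := polar_int hN _ i2
  rw [e3]
  have : ∀ z : sphere (0 : EuclideanSpace ℝ (Fin N)) 1 × Ioi (0 : ℝ),
      h (‖z.2.1 • z.1.1‖ • θ.1) = h (z.2.1 • θ.1) := by
    intro z
    have h1 : ‖z.1.1‖ = 1 := by simpa using z.1.2
    have h2 : (0 : ℝ) < z.2.1 := z.2.2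
    rw [norm_smul, h1, mul_one, Real.norm_of_nonneg h2.le]
  simp only [this]
  rw [integral_fun_snd (fun r : Ioi (0 : ℝ) => h (r.1 • θ.1)), smul_eq_mul]
  refine mul_pos ?_ hθ
  rw [Measure.toSphere_real_apply_univ]
  have : 0 < (volume : Measure (EuclideanSpace ℝ (Fin N))).real (ball 0 1) :=
    ENNReal.toReal_pos (measure_ball_pos _ _ one_pos).ne' measure_ball_lt_top.ne
  have h2 : 0 < Module.finrank ℝ (EuclideanSpace ℝ (Fin N)) := by
    rw [finrank_euclideanSpace_fin]; exact hN
  positivity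

/-- decreasing hull -/
noncomputable def hull (g : ℝ → ℝ) (r : ℝ) : ℝ := ⨆ s : ℝ, |g (max r s)|

lemma hull_le {g : ℝ → ℝ} {r c : ℝ} (h : ∀ z, r ≤ z → |g z| ≤ c) : hull g r ≤ c :=
  ciSup_le fun _ => h _ (le_max_left _ _)

lemma le_hull {g : ℝ → ℝ} {B : ℝ} (hB : ∀ r, |g r| ≤ B) {r z : ℝ} (h : r ≤ z) :
    |g z| ≤ hull g r := by
  have : BddAbove (range fun s : ℝ => |g (max r s)|) := ⟨B, by rintro _ ⟨s, rfl⟩; exact hB _⟩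
  have h2 := le_ciSup this z
  unfold hull
  simpa [h] using h2

lemma hull_anti {g : ℝ → ℝ} {B : ℝ} (hB : ∀ r, |g r| ≤ B) {r s : ℝ} (h : r ≤ s) :
    hull g s ≤ hull g r := hull_le fun _ hz => le_hull hB (h.trans hz)

lemma hull_lip {g : ℝ → ℝ} {B : ℝ} (hB : ∀ r, |g r| ≤ B) {K : ℝ≥0} {I : Set ℝ}
    (hI : I.OrdConnected) (hg : LipschitzOnWith K g I) : LipschitzOnWith K (hull g) I := by
  have key : ∀ s ∈ I, ∀ t ∈ I, s ≤ t → |hull g s - hull g t| ≤ K * |s - t| := by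
    intro s hs t ht hst
    rw [abs_of_nonneg (sub_nonneg.2 (hull_anti hB hst)), abs_sub_comm,
      abs_of_nonneg (sub_nonneg.2 hst), sub_le_iff_le_add]
    apply hull_le
    intro z hz
    rcases le_total t z with h | h
    · have := le_hull hB h
      have : 0 ≤ (K : ℝ) * (t - s) := mul_nonneg K.2 (sub_nonneg.2 hst)
      linarith
    · have h1 := hg.dist_le_mul z (hI.out hs ht ⟨hz, h⟩) t ht
      rw [Real.dist_eq, Real.dist_eq, abs_sub_comm z t, abs_of_nonneg (sub_nonneg.2 h)] at h1
      have h2 := le_hull hB (le_refl t)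
      have h3 : |g z| ≤ |g z - g t| + |g t| := by simpa using abs_add_le (g z - g t) (g t)
      have h4 : (K : ℝ) * (t - z) ≤ K * (t - s) := by gcongr
      linarith
  refine LipschitzOnWith.of_dist_le_mul fun s hs t ht => ?_
  rw [Real.dist_eq, Real.dist_eq]
  rcases le_total s t with h | h
  · exact key s hs t ht h
  · rw [abs_sub_comm, abs_sub_comm s t]; exact key t ht s hs h

lemma radial (hN : 0 < N) {p ε : ℝ} (hp : 1 < p) (hε : 0 < ε) :
    ∃ G : ℝ → ℝ, (∀ r s, r ≤ s → G s ≤ G r) ∧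
      Adm (ball (0 : EuclideanSpace ℝ (Fin N)) 1) (fun y => G ‖y‖) ∧
      0 < Qn p (fun y : EuclideanSpace ℝ (Fin N) => G ‖y‖) ∧
      En p (fun y : EuclideanSpace ℝ (Fin N) => G ‖y‖) ≤
        (lambdaPQ p p (ball (0 : EuclideanSpace ℝ (Fin N)) 1) + ε) *
          Qn p (fun y : EuclideanSpace ℝ (Fin N) => G ‖y‖) := by
  have hp0 : 0 < p := by linarith
  have hlam := lambda_ball_pos hN hp
  set lam := lambdaPQ p p (ball (0 : EuclideanSpace ℝ (Fin N)) 1) with hlamdef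
  obtain ⟨ψ, h1, h2, h3, h4, h5⟩ := exists_test hN hp hε
  rw [← hlamdef] at h5
  obtain ⟨R, hR1, hR⟩ := exists_lt_subset_ball (isClosed_tsupport ψ) h3
  have hz : ∀ x, R ≤ ‖x‖ → x ∉ tsupport ψ := fun x hx hx' => by
    have := mem_ball_zero_iff.1 (hR hx'); linarith
  have hψ0 : ∀ x, R ≤ ‖x‖ → ψ x = 0 := fun x hx => image_eq_zero_of_notMem_tsupport (hz x hx)
  have hψ1 : ∀ x, R ≤ ‖x‖ → fderiv ℝ ψ x = 0 := fun x hx => by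
    by_contra h
    exact hz x hx (support_fderiv_subset ℝ h)
  obtain ⟨K, hK⟩ := h1.lipschitzWith_of_hasCompactSupport h2 (by simp)
  let h : EuclideanSpace ℝ (Fin N) → ℝ := fun x =>
    (lam + ε) * |ψ x| ^ p - ‖fderiv ℝ ψ x‖ ^ p
  have hc : Continuous h := by
    apply Continuous.sub
    · exact (h1.continuous.abs.rpow_const fun _ => Or.inr hp0.le).const_mul _
    · exact ((h1.continuous_fderiv (by simp)).norm.rpow_const fun _ => Or.inr hp0.le)
  have hh0 : ∀ x, R ≤ ‖x‖ → h x = 0 := fun x hx => by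
    simp only [h]
    rw [hψ0 x hx, hψ1 x hx]
    simp [Real.zero_rpow hp0.ne']
  have hpos : 0 < ∫ x, h x := by
    simp only [h]
    rw [integral_sub ((cont_pow_integrable hp0 h1.continuous h2).const_mul _)
      (lip_grad_integrable hp0 hK h2), integral_const_mul, h4]
    linarith
  obtain ⟨θ, hθ, hint, hθpos⟩ := polar_exists hN h hc hh0 hpos
  obtain ⟨B, hB'⟩ := h2.exists_bound_of_continuous h1.continuous
  let g : ℝ → ℝ := fun r => ψ (r • θ)
  have hB : ∀ r, |g r| ≤ B := fun r => hB' _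
  have hsm : LipschitzWith 1 (fun r : ℝ => r • θ) := by
    refine LipschitzWith.of_dist_le_mul fun r s => ?_
    rw [dist_eq_norm, ← sub_smul, norm_smul, hθ, mul_one, NNReal.coe_one, one_mul, dist_eq_norm]
  have hgL : LipschitzWith (K * 1) g := hK.comp hsm
  have hG0 : ∀ r, 0 ≤ hull g r := fun r => (abs_nonneg _).trans (le_hull hB (le_refl r))
  have hGL : LipschitzWith (K * 1) (hull g) := by
    rw [← lipschitzOnWith_univ] at hgL ⊢
    exact hull_lip hB ordConnected_univ hgL
  have hadm : Adm (ball (0 : EuclideanSpace ℝ (Fin N)) 1) (fun y => hull g ‖y‖) := by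
    refine Adm.of_support ⟨_, hGL.comp lipschitzWith_one_norm⟩ (isCompact_closedBall 0 R)
      (closedBall_subset_ball hR1) (fun x hx => ?_) (fun x => hG0 _)
    simp only [mem_closedBall, dist_zero_right, not_le] at hx
    refine le_antisymm (hull_le fun z hz' => ?_) (hG0 _)
    simp only [g]
    rw [hψ0, abs_zero]
    rw [norm_smul, hθ, mul_one]
    exact hx.le.trans (hz'.trans (le_abs_self z))
  have hgrad : ∀ y : EuclideanSpace ℝ (Fin N),
      ‖fderiv ℝ (fun y : EuclideanSpace ℝ (Fin N) => hull g ‖y‖) y‖ ≤ ‖fderiv ℝ ψ (‖y‖ • θ)‖ := by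
    intro y
    refine le_of_forall_gt_imp_ge_of_dense fun c hcgt => ?_
    lift c to ℝ≥0 using (norm_nonneg _).trans hcgt.le
    obtain ⟨t, ht, hlip⟩ := (h1.contDiffAt (x := ‖y‖ • θ)).of_le (m := 1) (by simp)
      |>.exists_lipschitzOnWith_of_nnnorm_lt c hcgt
    have hpre : (fun r : ℝ => r • θ) ⁻¹' t ∈ 𝓝 ‖y‖ := hsm.continuous.continuousAt ht
    obtain ⟨η, hη, hball⟩ := Metric.mem_nhds_iff.1 hpre
    have hg2 : LipschitzOnWith (c * 1) g (ball ‖y‖ η) :=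
      hlip.comp hsm.lipschitzOnWith (fun r hr => hball hr)
    have hG2 := hull_lip hB (by rw [Real.ball_eq_Ioo]; exact ordConnected_Ioo) hg2
    have hn : (fun y : EuclideanSpace ℝ (Fin N) => ‖y‖) ⁻¹' (ball ‖y‖ η) ∈ 𝓝 y :=
      continuous_norm.continuousAt (ball_mem_nhds _ hη)
    have := norm_fderiv_le_of_lipschitzOn ℝ hn
      (hG2.comp lipschitzWith_one_norm.lipschitzOnWith (fun r hr => hr))
    simpa [Function.comp_def] using this
  have hmain : 0 < (lam + ε) * Qn p (fun y : EuclideanSpace ℝ (Fin N) => hull g ‖y‖) -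
      En p (fun y : EuclideanSpace ℝ (Fin N) => hull g ‖y‖) := by
    refine hθpos.trans_le ?_
    unfold Qn En
    rw [← integral_const_mul, ← integral_sub ((hadm.intQ hp0).const_mul _) (hadm.intE hp0)]
    refine integral_mono hint (((hadm.intQ hp0).const_mul _).sub (hadm.intE hp0)) fun y => ?_
    have e1 : |ψ (‖y‖ • θ)| ^ p ≤ hull g ‖y‖ ^ p :=
      Real.rpow_le_rpow (abs_nonneg _) (le_hull hB (le_refl ‖y‖)) hp0.le
    have e2 := Real.rpow_le_rpow (norm_nonneg _) (hgrad y) hp0.le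
    have e3 := mul_le_mul_of_nonneg_left e1 (by linarith : (0 : ℝ) ≤ lam + ε)
    simp only [h]
    linarith
  have hE0 : 0 ≤ En p (fun y : EuclideanSpace ℝ (Fin N) => hull g ‖y‖) :=
    integral_nonneg fun x => by positivity
  refine ⟨hull g, fun r s hrs => hull_anti hB hrs, hadm, ?_, by linarith⟩
  have : 0 < (lam + ε) * Qn p (fun y : EuclideanSpace ℝ (Fin N) => hull g ‖y‖) := by linarith
  exact (mul_pos_iff_of_pos_left (by linarith)).1 this

end DistSumm

section DistSumm
open Filter Topology
open scoped NNReal ENNReal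
variable {N : ℕ} {Ω : Set (EuclideanSpace ℝ (Fin N))} {u v a b : EuclideanSpace ℝ (Fin N) → ℝ}

lemma conv_pow {p κ : ℝ} (hp : 0 < p) (hκ : 0 < κ) : ∃ C : ℝ, 0 < C ∧
    ∀ H w : ℝ, 0 ≤ H → 0 ≤ w → (H + w) ^ p ≤ (1 + κ) * H ^ p + C * w ^ p := by
  set δ := (1 + κ) ^ (1 / p) - 1 with hδ
  have hδ0 : 0 < δ := by
    have : 1 < (1 + κ) ^ (1 / p) := Real.one_lt_rpow (by linarith) (by positivity)
    linarith
  have hδ1 : (1 + δ) ^ p = 1 + κ := by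
    rw [hδ, add_sub_cancel, ← Real.rpow_mul (by linarith), one_div_mul_cancel hp.ne', Real.rpow_one]
  refine ⟨(1 + 1 / δ) ^ p, by positivity, fun H w hH hw => ?_⟩
  rcases le_total w (δ * H) with h | h
  · have : (H + w) ^ p ≤ ((1 + δ) * H) ^ p := Real.rpow_le_rpow (by positivity) (by linarith) hp.le
    rw [Real.mul_rpow (by positivity) hH, hδ1] at this
    have h2 : 0 ≤ (1 + 1 / δ) ^ p * w ^ p := by positivity
    linarith
  · have h3 : H ≤ 1 / δ * w := by rw [one_div, le_inv_mul_iff₀ hδ0]; exact h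
    have : (H + w) ^ p ≤ ((1 + 1 / δ) * w) ^ p :=
      Real.rpow_le_rpow (by positivity) (by linarith) hp.le
    rw [Real.mul_rpow (by positivity) hw] at this
    have h2 : 0 ≤ (1 + κ) * H ^ p := by positivity
    linarith

lemma trunc (hN : 0 < N) {p κ : ℝ} (hp : 1 < p) (hκ : 0 < κ) : ∃ ρ₀ : ℝ, 0 < ρ₀ ∧
    ∀ ρ, 0 < ρ → ρ ≤ ρ₀ → ∃ b : EuclideanSpace ℝ (Fin N) → ℝ, Adm (ball 0 1) b ∧
      (∀ y, b y ≤ 1) ∧ (∀ y, ‖y‖ ≤ ρ → b y = 1) ∧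
      En p b ≤ lambdaPQ p p (ball (0 : EuclideanSpace ℝ (Fin N)) 1) * Qn p b +
        κ * (volume : Measure (EuclideanSpace ℝ (Fin N))).real (closedBall 0 ρ) := by
  have hp0 : 0 < p := by linarith
  have hlam := lambda_ball_pos hN hp
  set lam := lambdaPQ p p (ball (0 : EuclideanSpace ℝ (Fin N)) 1) with hlamdef
  obtain ⟨C, hC0, hC⟩ := conv_pow (κ := κ / (4 * lam)) hp0 (by positivity)
  refine ⟨1 / 2 * (1 / (2 * C + 3)) ^ (1 / p), by positivity, fun ρ hρ hρle => ?_⟩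
  have hρp : 2 * C + 3 ≤ (2 * ρ)⁻¹ ^ p := by
    have h1 : (2 * ρ) ^ p ≤ ((1 / (2 * C + 3)) ^ (1 / p)) ^ p :=
      Real.rpow_le_rpow (by positivity) (by linarith) hp0.le
    rw [← Real.rpow_mul (by positivity), one_div_mul_cancel hp0.ne', Real.rpow_one] at h1
    rw [Real.inv_rpow (by positivity), le_inv_comm₀ (by positivity) (by positivity)]
    simpa using h1
  set V := (volume : Measure (EuclideanSpace ℝ (Fin N))).real (closedBall 0 ρ) with hV
  set V1 := (volume : Measure (EuclideanSpace ℝ (Fin N))).real (ball 0 1) with hV1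
  have hVpos : 0 < V :=
    ENNReal.toReal_pos (measure_closedBall_pos _ _ hρ).ne' measure_closedBall_lt_top.ne
  have hV1pos : 0 < V1 :=
    ENNReal.toReal_pos (measure_ball_pos _ _ one_pos).ne' measure_ball_lt_top.ne
  set ε := min lam (κ * V / (2 * V1)) with hε
  have hε0 : 0 < ε := lt_min hlam (by positivity)
  have hε1 : ε ≤ lam := min_le_left _ _
  have hε2 : ε * V1 ≤ κ * V / 2 := by
    have : ε ≤ κ * V / (2 * V1) := min_le_right _ _
    calc ε * V1 ≤ κ * V / (2 * V1) * V1 := by gcongr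
      _ = κ * V / 2 := by field_simp
  obtain ⟨G, hG, hA, hQ, hE⟩ := radial hN hp hε0
  rw [← hlamdef] at hE
  set φ : EuclideanSpace ℝ (Fin N) → ℝ := fun y => G ‖y‖ with hφ
  obtain ⟨x₁, hx₁⟩ : ∃ x : EuclideanSpace ℝ (Fin N), ‖x‖ = ρ := by
    have : Nonempty (Fin N) := ⟨⟨0, hN⟩⟩
    exact exists_norm_eq _ hρ.le
  set H := G ρ with hH
  have hH0 : 0 ≤ H := by have := hA.nonneg x₁; simp only [hφ, hx₁] at this; exact this
  have hin : ∀ y : EuclideanSpace ℝ (Fin N), ‖y‖ ≤ ρ → H ≤ φ y := fun y hy => hG _ _ hy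
  have hout : ∀ y : EuclideanSpace ℝ (Fin N), ρ < ‖y‖ → φ y ≤ H := fun y hy => hG _ _ hy.le
  obtain ⟨K, hK⟩ := hA.lip
  set w : EuclideanSpace ℝ (Fin N) → ℝ := fun y => max (φ y) H - H with hw
  set b₀ : EuclideanSpace ℝ (Fin N) → ℝ := fun y => min (φ y) H with hb₀
  have hMl : LipschitzWith K (fun y => max (φ y) H) := hK.max_const H
  have hml : LipschitzWith K (fun y => min (φ y) H) := hK.min_const H
  have hwl : LipschitzWith (K + 0) w := hMl.sub (LipschitzWith.const H)
  have hw0 : ∀ y, 0 ≤ w y := fun y => sub_nonneg.2 (le_max_right _ _)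
  have hwA : Adm (ball 0 (2 * ρ)) w := by
    refine Adm.of_support ⟨_, hwl⟩ (isCompact_closedBall 0 ρ)
      (closedBall_subset_ball (by linarith)) (fun y hy => ?_) hw0
    simp only [mem_closedBall, dist_zero_right, not_le] at hy
    simp only [hw, max_eq_right (hout y hy), sub_self]
  have hbA : Adm (ball 0 1) b₀ :=
    hA.of_le ⟨_, hml⟩ (fun y => le_min (hA.nonneg y) hH0) (fun y => min_le_left _ _)
  have hEsum : En p φ = En p b₀ + En p w := by
    unfold En
    rw [← integral_add (hbA.intE hp0) (hwA.intE hp0)]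
    apply integral_congr_ae
    filter_upwards [hA.ae_diff, hbA.ae_diff, hMl.ae_differentiableAt] with y h1 h2 h3
    have := grad_modular p h1 (differentiableAt_const H) h3 h2
    have e : fderiv ℝ w y = fderiv ℝ (fun y => max (φ y) H) y := by
      simp only [hw]
      rw [fderiv_sub_const]
    rw [e]
    simp only [fderiv_fun_const, Pi.zero_apply, norm_zero, Real.zero_rpow hp0.ne'] at this
    simp only [hb₀]
    linarith
  have hEw := ball_ineq hp0 (by positivity) hwA
  rw [← hlamdef] at hEw
  have hQw : 0 ≤ Qn p w := integral_nonneg fun y => Real.rpow_nonneg (hw0 y) _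
  have hEb0 : 0 ≤ En p b₀ := integral_nonneg fun x => by positivity
  have hHpos : 0 < H := by
    refine lt_of_le_of_ne hH0 fun h0 => ?_
    have : w = φ := by
      funext y
      simp only [hw, ← h0, sub_zero]
      exact max_eq_left (hA.nonneg y)
    rw [this] at hEw
    have h1 : lam * (2 * ρ)⁻¹ ^ p * Qn p φ ≤ (lam + ε) * Qn p φ := hEw.trans hE
    have h2 := le_of_mul_le_mul_right h1 hQ
    nlinarith
  have hQle : Qn p φ ≤ Qn p b₀ + κ / (4 * lam) * H ^ p * V + C * Qn p w := by
    have i1 := hbA.intQ hp0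
    have i2 : Integrable ((closedBall (0 : EuclideanSpace ℝ (Fin N)) ρ).indicator
        (fun _ => κ / (4 * lam) * H ^ p)) :=
      (integrable_indicator_iff measurableSet_closedBall).2
        (integrableOn_const measure_closedBall_lt_top.ne)
    have i3 := (hwA.intQ hp0).const_mul C
    have e2 : ∫ y, (closedBall (0 : EuclideanSpace ℝ (Fin N)) ρ).indicator
        (fun _ => κ / (4 * lam) * H ^ p) y = κ / (4 * lam) * H ^ p * V := by
      rw [integral_indicator measurableSet_closedBall, setIntegral_const, smul_eq_mul, mul_comm]
    unfold Qn
    rw [← e2, ← integral_const_mul, ← integral_add i1 i2, ← integral_add (f := fun y => b₀ y ^ p + _) (i1.add i2) i3]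
    refine integral_mono (hA.intQ hp0) ((i1.add i2).add i3) fun y => ?_
    simp only [Pi.add_apply]
    rcases le_or_gt ‖y‖ ρ with hy | hy
    · have h1 := hin y hy
      rw [indicator_of_mem (by simpa using hy)]
      have h2 : φ y = H + w y := by simp only [hw, max_eq_left h1]; ring
      have h3 : b₀ y = H := min_eq_right h1
      rw [h3]
      have := hC H (w y) hH0 (hw0 y)
      rw [← h2] at this
      linarith
    · have h1 := hout y hy
      rw [indicator_of_notMem (by simpa using hy)]
      have h3 : b₀ y = φ y := min_eq_left h1
      rw [h3]
      have : 0 ≤ C * w y ^ p := mul_nonneg hC0.le (Real.rpow_nonneg (hw0 y) _)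
      linarith
  have hHp : 0 < H ^ p := by positivity
  have hmain : En p b₀ ≤ (lam + ε) * Qn p b₀ + κ / 2 * H ^ p * V := by
    have h1 := mul_le_mul_of_nonneg_left hQle (by linarith : 0 ≤ lam + ε)
    have h2 : (lam + ε) * (C * Qn p w) ≤ lam * (2 * ρ)⁻¹ ^ p * Qn p w := by
      have : (lam + ε) * C ≤ lam * (2 * ρ)⁻¹ ^ p := by nlinarith
      calc _ = (lam + ε) * C * Qn p w := by ring
        _ ≤ _ := mul_le_mul_of_nonneg_right this hQw
    have h3 : (lam + ε) * (κ / (4 * lam) * H ^ p * V) ≤ κ / 2 * H ^ p * V := by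
      calc _ ≤ (2 * lam) * (κ / (4 * lam) * H ^ p * V) := by
            apply mul_le_mul_of_nonneg_right (by linarith) (by positivity)
        _ = _ := by field_simp; ring
    linarith
  refine ⟨fun y => H⁻¹ * b₀ y, hbA.smul (by positivity), fun y => ?_, fun y hy => ?_, ?_⟩
  · rw [inv_mul_le_iff₀ hHpos, mul_one]; exact min_le_right _ _
  · have h3 : b₀ y = H := min_eq_right (hin y hy)
    simp only [h3, inv_mul_cancel₀ hHpos.ne']
  · have hQ1 : Qn p b₀ ≤ H ^ p * V1 := by
      have e2 : ∫ y, (ball (0 : EuclideanSpace ℝ (Fin N)) 1).indicator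
        (fun _ => H ^ p) y = H ^ p * V1 := by
        rw [integral_indicator measurableSet_ball, setIntegral_const, smul_eq_mul, mul_comm]
      rw [← e2]
      refine integral_mono (hbA.intQ hp0) ((integrable_indicator_iff measurableSet_ball).2
        (integrableOn_const measure_ball_lt_top.ne)) fun y => ?_
      by_cases hy : y ∈ ball (0 : EuclideanSpace ℝ (Fin N)) 1
      · rw [indicator_of_mem hy]
        exact Real.rpow_le_rpow (hbA.nonneg y) (min_le_right _ _) hp0.le
      · rw [indicator_of_notMem hy]
        have : b₀ y = 0 := image_eq_zero_of_notMem_tsupport fun h => hy (hbA.sub h)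
        simp only [this, Real.zero_rpow hp0.ne', le_refl]
    rw [En_smul (by positivity), Qn_smul (by positivity) hbA.nonneg, Real.inv_rpow hH0]
    have h5 : En p b₀ ≤ lam * Qn p b₀ + H ^ p * (κ * V) := by
      have := mul_le_mul_of_nonneg_left hQ1 hε0.le
      have := mul_le_mul_of_nonneg_left hε2 hHp.le
      nlinarith
    calc (H ^ p)⁻¹ * En p b₀ ≤ (H ^ p)⁻¹ * (lam * Qn p b₀ + H ^ p * (κ * V)) := by gcongr
      _ = _ := by field_simp

end DistSumm

section DistSumm
open Filter Topology
open scoped NNReal ENNReal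
variable {N : ℕ} {Ω : Set (EuclideanSpace ℝ (Fin N))} {u v a b : EuclideanSpace ℝ (Fin N) → ℝ}

lemma bern {p q τ : ℝ} (hq : 0 < q) (hqp : q ≤ p) (hτ : 0 ≤ τ) :
    q * (1 - τ ^ p) ≤ p * (1 - τ ^ q) := by
  have h := one_add_mul_self_le_rpow_one_add (s := τ ^ q - 1) (p := p / q)
    (by have := Real.rpow_nonneg hτ q; linarith) (by rwa [one_le_div hq])
  rw [add_sub_cancel, ← Real.rpow_mul hτ, mul_div_cancel₀ _ hq.ne'] at h
  have h2 := mul_le_mul_of_nonneg_left h hq.le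
  have h3 : q * (1 + p / q * (τ ^ q - 1)) = q + p * (τ ^ q - 1) := by field_simp
  linarith

lemma pw_ineq {p q m A y z : ℝ} (hq : 0 < q) (hqp : q < p) (hm : 0 ≤ m) (hA : 0 < A)
    (hmA : m * A ^ p = A ^ q) (hy : 0 ≤ y) (hyz : y ≤ z) (hzA : z ≤ A) :
    q * (m * (z ^ p - y ^ p)) ≤ p * (z ^ q - y ^ q) := by
  have hp : 0 < p := hq.trans hqp
  rcases (hy.trans hyz).eq_or_lt with h0 | h0
  · have : y = 0 := le_antisymm (h0 ▸ hyz) hy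
    rw [← h0, this]; simp
  have hb := bern hq hqp.le (div_nonneg hy h0.le)
  rw [Real.div_rpow hy h0.le, Real.div_rpow hy h0.le] at hb
  have e1 : z ^ p = z ^ (p - q) * z ^ q := by rw [← Real.rpow_add h0]; congr 1; ring
  have eA : A ^ p = A ^ (p - q) * A ^ q := by rw [← Real.rpow_add hA]; congr 1; ring
  have hzp : 0 < z ^ p := by positivity
  have hzq : 0 < z ^ q := by positivity
  have h1 := mul_le_mul_of_nonneg_left hb hzp.le
  have e2 : z ^ p * (q * (1 - y ^ p / z ^ p)) = q * (z ^ p - y ^ p) := by field_simp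
  have e3 : z ^ p * (p * (1 - y ^ q / z ^ q)) = z ^ (p - q) * (p * (z ^ q - y ^ q)) := by
    rw [e1]; field_simp
  rw [e2, e3] at h1
  have h2 : m * A ^ (p - q) = 1 := by
    have hAq : 0 < A ^ q := by positivity
    rw [eA, ← mul_assoc] at hmA
    exact (mul_eq_right₀ hAq.ne').1 hmA
  have h3 : m * z ^ (p - q) ≤ 1 := by
    rw [← h2]
    have := Real.rpow_le_rpow h0.le hzA (by linarith : 0 ≤ p - q)
    gcongr
  have h4 : 0 ≤ p * (z ^ q - y ^ q) :=
    mul_nonneg hp.le (sub_nonneg.2 (Real.rpow_le_rpow hy hyz hq.le))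
  have h5 := mul_le_mul_of_nonneg_left h1 hm
  have h6 := mul_le_mul_of_nonneg_right h3 h4
  nlinarith

lemma submin_ball {p q κ V A d lam : ℝ} (hq : 0 < q) (hqp : q < p) (hlam : 0 < lam)
    (hlamdef : lam = lambdaPQ p p (ball (0 : EuclideanSpace ℝ (Fin N)) 1))
    (hb : Adm (ball 0 1) b) (hb1 : ∀ y, b y ≤ 1) (hE : En p b ≤ lam * Qn p b + κ * V)
    (hA : 0 < A) (hd : 0 < d) (hAd : lam * d⁻¹ ^ p * A ^ p = A ^ q)
    (x : EuclideanSpace ℝ (Fin N)) :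
    SubMin p q Ω (q * κ / lam * (A ^ q * (d ^ N * V))) (fun y => A * b (d⁻¹ • (y - x))) := by
  have hp : 0 < p := hq.trans hqp
  have hu := hb.scale_ball hA.le hd x
  have hEu := En_scale (u := b) (p := p) hA.le hd x
  have hQu := Qn_scale (u := b) (s := p) hA.le hd hb.nonneg x
  have huA : ∀ y, A * b (d⁻¹ • (y - x)) ≤ A := fun y => by nlinarith [hb1 (d⁻¹ • (y - x))]
  set u := fun y => A * b (d⁻¹ • (y - x)) with hudef
  intro v hv hle
  have hv' : Adm (ball x d) v := hu.of_le hv.lip hv.nonneg hle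
  have hEv := ball_ineq hp hd hv'
  rw [← hlamdef] at hEv
  set m := lam * d⁻¹ ^ p with hm
  have hm0 : 0 ≤ m := by positivity
  have key : q * (m * (Qn p u - Qn p v)) ≤ p * (Qn q u - Qn q v) := by
    unfold Qn
    rw [← integral_sub (hu.intQ hp) (hv'.intQ hp), ← integral_sub (hu.intQ hq) (hv'.intQ hq),
      ← integral_const_mul, ← integral_const_mul, ← integral_const_mul]
    refine integral_mono ((((hu.intQ hp).sub (hv'.intQ hp)).const_mul m).const_mul q)
      (((hu.intQ hq).sub (hv'.intQ hq)).const_mul p) fun y => ?_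
    exact pw_ineq hq hqp hm0 hA hAd (hv.nonneg y) (hle y) (huA y)
  have hEu2 : En p u ≤ m * Qn p u + κ / lam * (A ^ q * (d ^ N * V)) := by
    have h0 : 0 ≤ A ^ p * (d⁻¹ ^ p * d ^ N) := by positivity
    have h1 := mul_le_mul_of_nonneg_left hE h0
    have e : κ / lam * (A ^ q * (d ^ N * V)) = A ^ p * (d⁻¹ ^ p * d ^ N) * (κ * V) := by
      rw [← hAd, hm]; field_simp
    rw [e, hEu, hQu, hm]
    linarith
  have h2 := mul_le_mul_of_nonneg_left hEu2 hq.le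
  have h3 := mul_le_mul_of_nonneg_left hEv hq.le
  have e4 : q * (κ / lam * (A ^ q * (d ^ N * V))) = q * κ / lam * (A ^ q * (d ^ N * V)) := by ring
  linarith

lemma vol_scale {d r : ℝ} (hd : 0 < d) (hr : 0 < r) (x : EuclideanSpace ℝ (Fin N)) :
    d ^ N * (volume : Measure (EuclideanSpace ℝ (Fin N))).real (closedBall 0 (r / d)) =
      (volume : Measure (EuclideanSpace ℝ (Fin N))).real (closedBall x r) := by
  rw [Measure.addHaar_real_closedBall _ _ (by positivity),
    Measure.addHaar_real_closedBall _ _ hr.le, finrank_euclideanSpace_fin, ← mul_assoc,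
    ← mul_pow, mul_div_cancel₀ _ hd.ne']

lemma exists_t {p q c : ℝ} (hq : 0 < q) (hqp : q < p) (hc : 1 < c) :
    ∃ t : ℝ, 0 < t ∧ t < 1 ∧ p * (1 - t ^ q) ≤ c * (q * (1 - t ^ p)) := by
  have hp : 0 < p := hq.trans hqp
  have hpq : 0 < p - q := by linarith
  have hc0 : 0 < c := by linarith
  set t := c ^ (-(1 / (p - q))) with ht
  have ht0 : 0 < t := by positivity
  have ht1 : t < 1 := Real.rpow_lt_one_of_one_lt_of_neg hc (by
    have : 0 < 1 / (p - q) := by positivity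
    linarith)
  refine ⟨t, ht0, ht1, ?_⟩
  have e : t ^ (p - q) = c⁻¹ := by
    rw [ht, ← Real.rpow_mul hc0.le, ← Real.rpow_neg_one]; congr 1; field_simp
  have hb := bern hq hqp.le (inv_nonneg.2 ht0.le)
  rw [Real.inv_rpow ht0.le, Real.inv_rpow ht0.le] at hb
  have e1 : t ^ p = c⁻¹ * t ^ q := by rw [← e, ← Real.rpow_add ht0]; congr 1; ring
  have htp : 0 < t ^ p := by positivity
  have htq : 0 < t ^ q := by positivity
  have h1 := mul_le_mul_of_nonneg_left hb (by positivity : 0 ≤ c * t ^ p)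
  have e2 : c * t ^ p * (q * (1 - (t ^ p)⁻¹)) = - (c * (q * (1 - t ^ p))) := by field_simp; ring
  have e3 : c * t ^ p * (p * (1 - (t ^ q)⁻¹)) = - (p * (1 - t ^ q)) := by
    rw [e1]; field_simp; ring
  linarith

lemma finite_bound (hN : 0 < N) {p q c : ℝ} (hq : 1 ≤ q) (hqp : q < p) (hΩ : IsOpen Ω)
    (hpos : 0 < lambdaPQ p q Ω) (hc : 1 < c) : ∃ ρ₀ : ℝ, 0 < ρ₀ ∧
    ∀ (s : Finset (EuclideanSpace ℝ (Fin N))) (d r : EuclideanSpace ℝ (Fin N) → ℝ),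
      (∀ x ∈ s, 0 < d x ∧ ball x (d x) ⊆ Ω ∧ 0 < r x ∧ r x ≤ ρ₀ * d x) →
      (s : Set (EuclideanSpace ℝ (Fin N))).PairwiseDisjoint (fun x => closedBall x (r x)) →
      ∑ x ∈ s, d x ^ (p * q / (p - q)) *
          (volume : Measure (EuclideanSpace ℝ (Fin N))).real (closedBall x (r x)) ≤
        (c * lambdaPQ p p (ball (0 : EuclideanSpace ℝ (Fin N)) 1) / lambdaPQ p q Ω)
          ^ (q / (p - q)) := by
  have hq0 : 0 < q := by linarith
  have hp1 : 1 < p := by linarith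
  have hp : 0 < p := by linarith
  have hpq : 0 < p - q := by linarith
  have hlam := lambda_ball_pos hN hp1
  set lam := lambdaPQ p p (ball (0 : EuclideanSpace ℝ (Fin N)) 1) with hlamdef
  set Lam := lambdaPQ p q Ω with hLamdef
  obtain ⟨t, ht0, ht1, ht⟩ := exists_t (c := (1 + c) / 2) hq0 hqp (by linarith)
  have htp : 0 < 1 - t ^ p := by
    have := Real.rpow_lt_one ht0.le ht1 hp; linarith
  set κ := lam * ((c - 1) / 2 * (1 - t ^ p)) with hκ
  have hκ0 : 0 < κ := by
    have : 0 < c - 1 := by linarith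
    positivity
  obtain ⟨ρ₀, hρ₀, hT⟩ := trunc hN hp1 hκ0
  refine ⟨ρ₀, hρ₀, fun s d r hs hdis => ?_⟩
  let A : EuclideanSpace ℝ (Fin N) → ℝ := fun x => (d x ^ p / lam) ^ (1 / (p - q))
  have hA0 : ∀ x ∈ s, 0 < A x := fun x hx => by
    have := (hs x hx).1
    positivity
  have hAeq : ∀ x ∈ s, lam * (d x)⁻¹ ^ p * A x ^ p = A x ^ q := fun x hx => by
    have hd := (hs x hx).1
    have h1 : A x ^ (p - q) = d x ^ p / lam := by
      simp only [A]
      rw [← Real.rpow_mul (by positivity), one_div_mul_cancel hpq.ne', Real.rpow_one]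
    have h2 : A x ^ p = A x ^ (p - q) * A x ^ q := by
      rw [← Real.rpow_add (hA0 x hx)]; congr 1; ring
    rw [h2, h1, Real.inv_rpow hd.le]
    have : 0 < d x ^ p := by positivity
    field_simp
  have hAq : ∀ x ∈ s, A x ^ q = lam⁻¹ ^ (q / (p - q)) * d x ^ (p * q / (p - q)) := fun x hx => by
    have hd := (hs x hx).1
    simp only [A]
    rw [← Real.rpow_mul (by positivity), div_eq_mul_inv (d x ^ p), Real.mul_rpow (by positivity) (by positivity),
      ← Real.rpow_mul hd.le, mul_comm]
    congr 2 <;> field_simp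
  have hb : ∀ x : EuclideanSpace ℝ (Fin N), ∃ b : EuclideanSpace ℝ (Fin N) → ℝ,
      x ∈ s → (Adm (ball 0 1) b ∧ (∀ y, b y ≤ 1) ∧ (∀ y, ‖y‖ ≤ r x / d x → b y = 1) ∧
      En p b ≤ lam * Qn p b +
        κ * (volume : Measure (EuclideanSpace ℝ (Fin N))).real (closedBall 0 (r x / d x))) := by
    intro x
    by_cases hx : x ∈ s
    · obtain ⟨h1, h2, h3, h4⟩ := hs x hx
      obtain ⟨b, hb⟩ := hT (r x / d x) (by positivity) (by rwa [div_le_iff₀ h1])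
      exact ⟨b, fun _ => hb⟩
    · exact ⟨0, fun h => absurd h hx⟩
  choose b hb using hb
  let f : EuclideanSpace ℝ (Fin N) → EuclideanSpace ℝ (Fin N) → ℝ :=
    fun x y => A x * b x ((d x)⁻¹ • (y - x))
  obtain ⟨U, hU, hUS, hUf⟩ := finset_sup (Ω := Ω) hp hq0 s f
    (fun x => q * κ / lam * (A x ^ q *
      (volume : Measure (EuclideanSpace ℝ (Fin N))).real (closedBall x (r x))))
    (fun x hx => ((hb x hx).1.scale_ball (hA0 x hx).le (hs x hx).1 x).mono (hs x hx).2.1)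
    (fun x hx => by
      obtain ⟨h1, h2, h3, h4⟩ := hb x hx
      have := submin_ball (Ω := Ω) hq0 hqp hlam hlamdef h1 h2 h4 (hA0 x hx) (hs x hx).1
        (hAeq x hx) x
      rwa [vol_scale (hs x hx).1 (hs x hx).2.2.1] at this)
  rw [← Finset.mul_sum] at hUS
  set Y := ∑ x ∈ s, A x ^ q *
    (volume : Measure (EuclideanSpace ℝ (Fin N))).real (closedBall x (r x)) with hY
  set Z := ∑ x ∈ s, d x ^ (p * q / (p - q)) *
    (volume : Measure (EuclideanSpace ℝ (Fin N))).real (closedBall x (r x)) with hZ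
  have hYZ : Y = lam⁻¹ ^ (q / (p - q)) * Z := by
    rw [hY, hZ, Finset.mul_sum]
    refine Finset.sum_congr rfl fun x hx => ?_
    rw [hAq x hx, mul_assoc]
  set X := Qn q U with hX
  have hY0 : 0 ≤ Y := Finset.sum_nonneg fun x hx => by
    have := hA0 x hx
    positivity
  have hYX : Y ≤ X := by
    have h1 : ∫ y in ⋃ x ∈ s, closedBall x (r x), U y ^ q =
        ∑ x ∈ s, ∫ y in closedBall x (r x), U y ^ q :=
      integral_biUnion_finset s (fun x _ => measurableSet_closedBall) hdis
        (fun x _ => (hU.intQ hq0).integrableOn)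
    have h2 : ∫ y in ⋃ x ∈ s, closedBall x (r x), U y ^ q ≤ X :=
      setIntegral_le_integral (hU.intQ hq0)
        (Eventually.of_forall fun y => Real.rpow_nonneg (hU.nonneg y) _)
    refine le_trans ?_ h2
    rw [h1]
    refine Finset.sum_le_sum fun x hx => ?_
    have e : A x ^ q * (volume : Measure (EuclideanSpace ℝ (Fin N))).real (closedBall x (r x))
        = ∫ y in closedBall x (r x), A x ^ q := by
      rw [setIntegral_const, smul_eq_mul, mul_comm]
    rw [e]
    refine setIntegral_mono_on (integrableOn_const measure_closedBall_lt_top.ne)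
      (hU.intQ hq0).integrableOn measurableSet_closedBall fun y hy => ?_
    refine Real.rpow_le_rpow (hA0 x hx).le ?_ hq0.le
    have h3 := hUf x hx y
    have hd := (hs x hx).1
    have h4 : b x ((d x)⁻¹ • (y - x)) = 1 := by
      apply (hb x hx).2.2.1
      rw [norm_smul, norm_inv, Real.norm_of_nonneg hd.le, ← dist_eq_norm, div_eq_inv_mul]
      have := mem_closedBall.1 hy
      gcongr
    simp only [f, h4, mul_one] at h3
    exact h3
  have hen := hUS.energy hU ht0.le ht1.le
  have hle := lambda_le hp hq0 hΩ hU
  rw [← hX, ← hLamdef] at hle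
  rw [← hX] at hen
  have hmain : Lam * X ^ (p / q) ≤ c * X := by
    have h1 := mul_le_mul_of_nonneg_left hle (by positivity : 0 ≤ q * (1 - t ^ p))
    have h2 : q * κ / lam * Y ≤ q * κ / lam * X := by gcongr
    have e : q * κ / lam = q * ((c - 1) / 2 * (1 - t ^ p)) := by rw [hκ]; field_simp
    have h3 := mul_le_mul_of_nonneg_right ht (hY0.trans hYX)
    rw [e] at hen h2
    have h4 : q * (1 - t ^ p) * (Lam * X ^ (p / q)) ≤ q * (1 - t ^ p) * (c * X) := by
      linarith
    exact le_of_mul_le_mul_left h4 (by positivity)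
  have hXle : X ≤ (c / Lam) ^ (q / (p - q)) := by
    rcases (hY0.trans hYX).eq_or_lt with h0 | h0
    · rw [← h0]; positivity
    have e1 : X ^ (p / q) = X ^ ((p - q) / q) * X := by
      rw [← Real.rpow_add_one h0.ne']; congr 1; field_simp; ring
    have h1 : X ^ ((p - q) / q) ≤ c / Lam := by
      rw [le_div_iff₀ hpos]
      rw [e1] at hmain
      refine le_of_mul_le_mul_right (?_ : _ * X ≤ c * X) h0
      linarith
    have h2 := Real.rpow_le_rpow (by positivity) h1 (by positivity : 0 ≤ q / (p - q))
    rw [← Real.rpow_mul h0.le] at h2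
    have e3 : (p - q) / q * (q / (p - q)) = 1 := by field_simp
    rwa [e3, Real.rpow_one] at h2
  have hYle := hYX.trans hXle
  rw [hYZ, Real.inv_rpow hlam.le, inv_mul_le_iff₀ (by positivity),
    ← Real.mul_rpow hlam.le (by positivity)] at hYle
  have e : c * lam / Lam = lam * (c / Lam) := by ring
  rw [e]
  exact hYle

end DistSumm

section DistSumm
open Filter Topology
open scoped NNReal ENNReal
variable {N : ℕ} {Ω : Set (EuclideanSpace ℝ (Fin N))} {u v a b : EuclideanSpace ℝ (Fin N) → ℝ}

lemma lint_bound (hN : 0 < N) {p q c : ℝ} (hq : 1 ≤ q) (hqp : q < p) (hΩ : IsOpen Ω)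
    (hne : Ω ≠ Set.univ) (hpos : 0 < lambdaPQ p q Ω) (hc : 1 < c) :
    ∫⁻ x in Ω, ENNReal.ofReal (infDist x Ωᶜ ^ (p * q / (p - q))) ≤
      ENNReal.ofReal (c ^ (p * q / (p - q)) *
        (c * lambdaPQ p p (ball (0 : EuclideanSpace ℝ (Fin N)) 1) / lambdaPQ p q Ω)
          ^ (q / (p - q))) := by
  have hpq : 0 < p - q := by linarith
  have hp : 0 < p := by linarith
  set s := p * q / (p - q) with hs
  have hs0 : 0 < s := by positivity
  have hd0 : ∀ x ∈ Ω, 0 < infDist x Ωᶜ := fun x hx =>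
    (hΩ.isClosed_compl.notMem_iff_infDist_pos (nonempty_compl.2 hne)).1 (not_not.2 hx)
  obtain ⟨ρ₀, hρ₀, hfin⟩ := finite_bound hN hq hqp hΩ hpos hc
  have hc1 : 0 < c - 1 := by linarith
  set ρ := min ρ₀ (c - 1) with hρ
  have hρ0 : 0 < ρ := lt_min hρ₀ hc1
  obtain ⟨t, r, htc, hts, hr, hcov, hdis⟩ := Besicovitch.exists_disjoint_closedBall_covering_ae
    (volume : Measure (EuclideanSpace ℝ (Fin N))) (fun _ => univ) Ω
    (fun x _ δ hδ => by rw [univ_inter]; exact nonempty_Ioo.2 hδ)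
    (fun x => ρ * infDist x Ωᶜ) (fun x hx => mul_pos hρ0 (hd0 x hx))
  have hle : ∫⁻ x in Ω, ENNReal.ofReal (infDist x Ωᶜ ^ s) ≤
      ∫⁻ x in ⋃ x ∈ t, closedBall x (r x), ENNReal.ofReal (infDist x Ωᶜ ^ s) :=
    lintegral_mono_set' (ae_le_set.2 hcov)
  refine hle.trans ?_
  rw [lintegral_biUnion htc (fun x _ => measurableSet_closedBall) hdis]
  refine ENNReal.summable.tsum_le_of_sum_le fun F => ?_
  have hb : ∀ x ∈ t, ∫⁻ y in closedBall x (r x), ENNReal.ofReal (infDist y Ωᶜ ^ s) ≤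
      ENNReal.ofReal (c ^ s * (infDist x Ωᶜ ^ s *
        (volume : Measure (EuclideanSpace ℝ (Fin N))).real (closedBall x (r x)))) := by
    intro x hx
    have hd := hd0 x (hts hx)
    have h1 : ∫⁻ y in closedBall x (r x), ENNReal.ofReal (infDist y Ωᶜ ^ s) ≤
        ∫⁻ y in closedBall x (r x), ENNReal.ofReal ((c * infDist x Ωᶜ) ^ s) := by
      refine setLIntegral_mono' measurableSet_closedBall fun y hy => ?_
      refine ENNReal.ofReal_le_ofReal (Real.rpow_le_rpow infDist_nonneg ?_ hs0.le)
      have h2 : infDist y Ωᶜ ≤ infDist x Ωᶜ + dist y x := infDist_le_infDist_add_dist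
      have h3 : dist y x ≤ r x := hy
      have h4 : r x < ρ * infDist x Ωᶜ := (hr x hx).2.2
      have h5 : ρ * infDist x Ωᶜ ≤ (c - 1) * infDist x Ωᶜ :=
        mul_le_mul_of_nonneg_right (min_le_right _ _) hd.le
      linarith
    refine h1.trans_eq ?_
    rw [setLIntegral_const, Real.mul_rpow (by linarith) hd.le, ← mul_assoc,
      ENNReal.ofReal_mul (p := c ^ s * infDist x Ωᶜ ^ s) (by positivity), Measure.real,
      ENNReal.ofReal_toReal measure_closedBall_lt_top.ne]
  have hnn : ∀ x : t, 0 ≤ c ^ s * (infDist x.1 Ωᶜ ^ s *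
        (volume : Measure (EuclideanSpace ℝ (Fin N))).real (closedBall x.1 (r x.1))) := fun x =>
    mul_nonneg (by positivity) (mul_nonneg (Real.rpow_nonneg infDist_nonneg _) measureReal_nonneg)
  refine (Finset.sum_le_sum fun x _ => hb x.1 x.2).trans ?_
  rw [← ENNReal.ofReal_sum_of_nonneg fun x _ => hnn x, ← Finset.mul_sum]
  refine ENNReal.ofReal_le_ofReal (mul_le_mul_of_nonneg_left ?_ (by positivity))
  have := hfin (F.map (Function.Embedding.subtype _)) (fun x => infDist x Ωᶜ) r
    (fun x hx => by
      obtain ⟨z, hz, rfl⟩ := Finset.mem_map.1 hx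
      have h1 := hd0 _ (hts z.2)
      refine ⟨h1, ball_infDist_compl_subset, (hr _ z.2).2.1, ?_⟩
      exact (hr _ z.2).2.2.le.trans (mul_le_mul_of_nonneg_right (min_le_left _ _) h1.le))
    (hdis.subset fun x hx => by
      obtain ⟨z, hz, rfl⟩ := Finset.mem_map.1 (Finset.mem_coe.1 hx)
      exact z.2)
  rw [Finset.sum_map] at this
  exact this

lemma lint_bound_lim (hN : 0 < N) {p q : ℝ} (hq : 1 ≤ q) (hqp : q < p) (hΩ : IsOpen Ω)
    (hne : Ω ≠ Set.univ) (hpos : 0 < lambdaPQ p q Ω) :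
    ∫⁻ x in Ω, ENNReal.ofReal (infDist x Ωᶜ ^ (p * q / (p - q))) ≤
      ENNReal.ofReal ((lambdaPQ p p (ball (0 : EuclideanSpace ℝ (Fin N)) 1) / lambdaPQ p q Ω)
          ^ (q / (p - q))) := by
  have hpq : 0 < p - q := by linarith
  have hp : 0 < p := by linarith
  have ht : Tendsto (fun c : ℝ => ENNReal.ofReal (c ^ (p * q / (p - q)) *
        (c * lambdaPQ p p (ball (0 : EuclideanSpace ℝ (Fin N)) 1) / lambdaPQ p q Ω)
          ^ (q / (p - q)))) (𝓝[>] 1) (𝓝 (ENNReal.ofReal (1 ^ (p * q / (p - q)) *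
        (1 * lambdaPQ p p (ball (0 : EuclideanSpace ℝ (Fin N)) 1) / lambdaPQ p q Ω)
          ^ (q / (p - q))))) := by
    refine tendsto_nhdsWithin_of_tendsto_nhds (ENNReal.tendsto_ofReal ?_)
    refine Tendsto.mul ?_ ?_
    · exact tendsto_id.rpow_const (Or.inr (by positivity))
    · exact ((tendsto_id.mul_const _).div_const _).rpow_const (Or.inr (by positivity))
  rw [Real.one_rpow, one_mul, one_mul] at ht
  refine ge_of_tendsto ht ?_
  filter_upwards [self_mem_nhdsWithin] with c hc
  exact lint_bound hN hq hqp hΩ hne hpos hc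

end DistSumm

/-- If `1 ≤ q < p < ∞` and `Ω ⊊ ℝ^N` is open with `λ_{p,q}(Ω) > 0`, then
`d_Ω ∈ L^{pq/(p-q)}(Ω)` and
`λ_{p,q}(Ω) (∫_Ω d_Ω^{pq/(p-q)})^{(p-q)/q} ≤ λ_p(B_1)`. -/
theorem distance_summability_of_embedding {N : ℕ} (hN : 0 < N) (p q : ℝ)
    (hq : 1 ≤ q) (hqp : q < p)
    (Ω : Set (EuclideanSpace ℝ (Fin N))) (hΩ : IsOpen Ω) (hne : Ω ≠ Set.univ)
    (hpos : 0 < lambdaPQ p q Ω) :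
    MeasureTheory.IntegrableOn
      (fun x => Metric.infDist x Ωᶜ ^ (p * q / (p - q))) Ω ∧
    lambdaPQ p q Ω * (∫ x in Ω, Metric.infDist x Ωᶜ ^ (p * q / (p - q))) ^ ((p - q)/q) ≤
      lambdaPQ p p (Metric.ball (0 : EuclideanSpace ℝ (Fin N)) 1) := by
  have hb := lint_bound_lim hN hq hqp hΩ hne hpos
  have hpq : 0 < p - q := by linarith
  have hp : 0 < p := by linarith
  have hq0 : 0 < q := by linarith
  have hlam := lambda_ball_pos hN (hq.trans_lt hqp)
  set lam := lambdaPQ p p (ball (0 : EuclideanSpace ℝ (Fin N)) 1) with hlamdef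
  set Lam := lambdaPQ p q Ω with hLamdef
  have h0 : ∀ x, 0 ≤ infDist x Ωᶜ ^ (p * q / (p - q)) :=
    fun x => Real.rpow_nonneg infDist_nonneg _
  have hm : AEStronglyMeasurable (fun x => infDist x Ωᶜ ^ (p * q / (p - q)))
      (volume.restrict Ω) :=
    ((continuous_infDist_pt _).measurable.pow_const _).aestronglyMeasurable
  constructor
  · refine ⟨hm, ?_⟩
    rw [hasFiniteIntegral_iff_ofReal (ae_of_all _ h0)]
    exact hb.trans_lt ENNReal.ofReal_lt_top
  · rw [integral_eq_lintegral_of_nonneg_ae (ae_of_all _ h0) hm]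
    have h1 := ENNReal.toReal_mono ENNReal.ofReal_ne_top hb
    rw [ENNReal.toReal_ofReal (by positivity)] at h1
    have h2 := Real.rpow_le_rpow ENNReal.toReal_nonneg h1 (by positivity : 0 ≤ (p - q) / q)
    have e : q / (p - q) * ((p - q) / q) = 1 := by field_simp
    rw [← Real.rpow_mul (by positivity), e, Real.rpow_one, le_div_iff₀ hpos] at h2
    linarith
end

section
/- Let N < p < ∞ and let Ω ⊊ ℝ^N be open with finite inradius r_Ω. Then 𝔥_p(Ω) ≤ λ_p(Ω) · r_Ω^p ≤ λ_p(B_1), where λ_p(Ω) is the first Dirichlet p-Poincaré constant inf{∫|∇u|^p / ∫|u|^p : u ∈ C_0^∞(Ω)} and 𝔥_p(Ω) is the sharp Hardy constant. Moreover for every open Ω ⊊ ℝ^N, λ_p(Ω) > 0 if and only if r_Ω < ∞. -/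
open Set Metric MeasureTheory

/-- The sharp Hardy constant `𝔥_p(Ω) = inf {∫_Ω |∇u|^p : u ∈ C_0^∞(Ω), ‖u/d_Ω‖_{L^p(Ω)} = 1}`. -/
noncomputable def hardyP {N : ℕ} (p : ℝ) (Ω : Set (EuclideanSpace ℝ (Fin N))) : ℝ :=
  sInf {E : ℝ | ∃ u : EuclideanSpace ℝ (Fin N) → ℝ, ContDiff ℝ (⊤ : ℕ∞) u ∧
    HasCompactSupport u ∧ tsupport u ⊆ Ω ∧
    (∫ x in Ω, (|u x| / Metric.infDist x Ωᶜ) ^ p) = 1 ∧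
    E = ∫ x in Ω, ‖gradient u x‖ ^ p}

theorem aux_point {N : ℕ} (p : ℝ) (hp : 1 ≤ p) (u : EuclideanSpace ℝ (Fin N) → ℝ)
    (hu : ContDiff ℝ 1 u) (y h : EuclideanSpace ℝ (Fin N)) (h0 : u y = 0) (k : ℕ) (hk : k ≠ 0) :
    ‖u (y + h)‖ₑ ^ p ≤ ∫⁻ s in Ioc (0:ℝ) 1,
      (ENNReal.ofReal (k * s ^ (k-1)) * ‖h‖ₑ * ‖fderiv ℝ u (y + s ^ k • h)‖ₑ) ^ p := by
  have hd : Continuous (fderiv ℝ u) := hu.continuous_fderiv one_ne_zero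
  set g : ℝ → ℝ := fun s => (k * s ^ (k-1)) * fderiv ℝ u (y + s ^ k • h) h with hg
  have hgc : Continuous g := by fun_prop
  have hder : ∀ s : ℝ, HasDerivAt (fun s : ℝ => u (y + s ^ k • h)) (g s) s := by
    intro s
    have h1 : HasDerivAt (fun s : ℝ => y + s ^ k • h) ((k * s ^ (k-1)) • h) s := by
      have := ((hasDerivAt_pow k s).smul_const h).const_add y
      simpa using this
    have h2 := ((hu.differentiable one_ne_zero) (y + s ^ k • h)).hasFDerivAt
    have h3 := h2.comp_hasDerivAt s h1
    simp only [hg, map_smul, smul_eq_mul] at h3 ⊢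
    exact h3
  have hint := intervalIntegral.integral_eq_sub_of_hasDerivAt (a := 0) (b := 1)
    (fun s _ => hder s) (hgc.intervalIntegrable _ _)
  have hE : u (y + h) = ∫ s in Ioc (0:ℝ) 1, g s := by
    rw [← intervalIntegral.integral_of_le zero_le_one, hint]
    simp [hk, h0]
  have : IsProbabilityMeasure (volume.restrict (Ioc (0:ℝ) 1)) := ⟨by simp⟩
  have hJ := eLpNorm_le_eLpNorm_of_exponent_le (p := 1) (q := ENNReal.ofReal p)
    (μ := volume.restrict (Ioc (0:ℝ) 1)) (f := g) (by simpa using hp)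
    hgc.aestronglyMeasurable
  have hp0 : 0 < p := by linarith
  rw [eLpNorm_one_eq_lintegral_enorm, eLpNorm_eq_lintegral_rpow_enorm_toReal (by simpa using hp0)
    (by simp), ENNReal.toReal_ofReal hp0.le] at hJ
  calc ‖u (y + h)‖ₑ ^ p ≤ (∫⁻ s in Ioc (0:ℝ) 1, ‖g s‖ₑ) ^ p := by
        rw [hE]; gcongr; exact enorm_integral_le_lintegral_enorm _
    _ ≤ ((∫⁻ s in Ioc (0:ℝ) 1, ‖g s‖ₑ ^ p) ^ (1 / p)) ^ p := by gcongr
    _ = ∫⁻ s in Ioc (0:ℝ) 1, ‖g s‖ₑ ^ p := by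
        rw [← ENNReal.rpow_mul, one_div_mul_cancel hp0.ne', ENNReal.rpow_one]
    _ ≤ _ := by
        apply setLIntegral_mono' measurableSet_Ioc
        intro s hs
        gcongr
        rw [hg]
        rw [mul_assoc]
        refine (enorm_mul _ _).le.trans ?_
        refine mul_le_mul' ?_ ?_
        · rw [Real.enorm_of_nonneg (by have := hs.1.le; positivity)]
        · rw [mul_comm]; exact (fderiv ℝ u _).le_opENorm h

theorem aux_scale {N : ℕ} (G : EuclideanSpace ℝ (Fin N) → ENNReal) (hG : Measurable G)
    (y : EuclideanSpace ℝ (Fin N)) (ρ r : ℝ) (hr : 0 < r) (hr1 : r ≤ 1) :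
    ∫⁻ h in ball (0 : EuclideanSpace ℝ (Fin N)) ρ, G (y + r • h) ≤
      ENNReal.ofReal ((r ^ N)⁻¹) * ∫⁻ x in ball y ρ, G x := by
  set H : EuclideanSpace ℝ (Fin N) → ENNReal := fun h => (ball y ρ).indicator G (y + h) with hH
  have hHm : Measurable H := (hG.indicator measurableSet_ball).comp (measurable_const_add y)
  calc ∫⁻ h in ball (0 : EuclideanSpace ℝ (Fin N)) ρ, G (y + r • h)
      ≤ ∫⁻ h in ball (0 : EuclideanSpace ℝ (Fin N)) ρ, H (r • h) := by
        apply setLIntegral_mono' measurableSet_ball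
        intro h hh
        rw [hH]
        have : y + r • h ∈ ball y ρ := by
          simp only [mem_ball, dist_self_add_left, dist_zero_right] at hh ⊢
          rw [norm_smul, Real.norm_of_nonneg hr.le]
          nlinarith [norm_nonneg h]
        simp [indicator_of_mem this]
    _ ≤ ∫⁻ h, H (r • h) := setLIntegral_le_lintegral _ _
    _ = ∫⁻ h, H h ∂(Measure.map (r • ·) volume) := by
        rw [lintegral_map hHm (measurable_const_smul r)]
    _ = ENNReal.ofReal ((r ^ N)⁻¹) * ∫⁻ h, H h := by
        rw [Measure.map_addHaar_smul _ hr.ne', lintegral_smul_measure, finrank_euclideanSpace_fin,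
          abs_of_pos (by positivity), smul_eq_mul]
    _ = _ := by
        rw [hH, lintegral_add_left_eq_self (fun x => (ball y ρ).indicator G x) y,
          lintegral_indicator measurableSet_ball]

theorem aux_ball {N : ℕ} (p : ℝ) (hp : 1 ≤ p) (u : EuclideanSpace ℝ (Fin N) → ℝ)
    (hu : ContDiff ℝ 1 u) (y : EuclideanSpace ℝ (Fin N)) (h0 : u y = 0) (k : ℕ) (hk : k ≠ 0)
    (hkp : (k * N : ℝ) ≤ (k - 1) * p) (ρ : ℝ) :
    ∫⁻ x in ball y ρ, ‖u x‖ₑ ^ p ≤ ENNReal.ofReal (k * ρ) ^ p *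
      ∫⁻ x in ball y ρ, ‖fderiv ℝ u x‖ₑ ^ p := by
  have hd : Continuous (fderiv ℝ u) := hu.continuous_fderiv one_ne_zero
  have hp0 : 0 ≤ p := by linarith
  set G : EuclideanSpace ℝ (Fin N) → ENNReal := fun x => ‖fderiv ℝ u x‖ₑ ^ p with hG
  have hGm : Measurable G := by
    have : Measurable (fderiv ℝ u) := hd.measurable
    exact this.enorm.pow_const p
  set B := ball (0 : EuclideanSpace ℝ (Fin N)) ρ
  calc ∫⁻ x in ball y ρ, ‖u x‖ₑ ^ p = ∫⁻ h in B, ‖u (y + h)‖ₑ ^ p := by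
        rw [← lintegral_indicator measurableSet_ball, ← lintegral_indicator measurableSet_ball,
          ← lintegral_add_left_eq_self _ y]
        congr 1; ext h
        by_cases hh : h ∈ B
        · have h2 : y + h ∈ ball y ρ := by simpa [B] using hh
          rw [indicator_of_mem h2, indicator_of_mem hh]
        · have h2 : y + h ∉ ball y ρ := by simpa [B] using hh
          rw [indicator_of_notMem h2, indicator_of_notMem hh]
    _ ≤ ∫⁻ h in B, ∫⁻ s in Ioc (0:ℝ) 1,
          (ENNReal.ofReal (k * ρ * s ^ (k-1))) ^ p * G (y + s ^ k • h) := by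
        apply setLIntegral_mono' measurableSet_ball
        intro h hh
        refine (aux_point p hp u hu y h h0 k hk).trans ?_
        apply setLIntegral_mono' measurableSet_Ioc
        intro s hs
        rw [hG, ← ENNReal.mul_rpow_of_nonneg _ _ hp0]
        gcongr
        have hh' : ‖h‖ ≤ ρ := by simpa [B] using (mem_ball.1 hh).le
        rw [← ofReal_norm, ← ENNReal.ofReal_mul (by have := hs.1.le; positivity)]
        apply ENNReal.ofReal_le_ofReal
        have := hs.1.le
        have : 0 ≤ (k:ℝ) * s ^ (k-1) := by positivity
        nlinarith
    _ = ∫⁻ s in Ioc (0:ℝ) 1, ∫⁻ h in B,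
          (ENNReal.ofReal (k * ρ * s ^ (k-1))) ^ p * G (y + s ^ k • h) := by
        apply lintegral_lintegral_swap
        apply Measurable.aemeasurable
        apply Measurable.mul
        · have : Measurable fun z : EuclideanSpace ℝ (Fin N) × ℝ => k * ρ * z.2 ^ (k-1) := by
            fun_prop
          exact this.ennreal_ofReal.pow_const p
        · apply hGm.comp
          have : Continuous fun z : EuclideanSpace ℝ (Fin N) × ℝ => y + z.2 ^ k • z.1 := by
            fun_prop
          exact this.measurable
    _ ≤ ∫⁻ s in Ioc (0:ℝ) 1, ENNReal.ofReal (k * ρ) ^ p * ∫⁻ x in ball y ρ, G x := by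
        apply setLIntegral_mono' measurableSet_Ioc
        intro s hs
        have hs0 : 0 < s := hs.1
        have hm : Measurable fun h : EuclideanSpace ℝ (Fin N) => G (y + s ^ k • h) := by
          apply hGm.comp
          have : Continuous fun z : EuclideanSpace ℝ (Fin N) => y + s ^ k • z := by
            fun_prop
          exact this.measurable
        rw [lintegral_const_mul _ hm]
        refine (mul_le_mul_right (aux_scale G hGm y ρ (s ^ k) (by positivity)
          (pow_le_one₀ hs0.le hs.2)) _).trans ?_
        rw [← mul_assoc]
        gcongr
        rw [ENNReal.ofReal_mul' (by positivity), ENNReal.mul_rpow_of_nonneg _ _ hp0, mul_assoc]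
        refine mul_le_of_le_one_right' ?_
        rw [ENNReal.ofReal_rpow_of_nonneg (by positivity) hp0, ← ENNReal.ofReal_mul (by positivity)]
        rw [ENNReal.ofReal_le_one]
        have e1 : (s ^ (k-1)) ^ p = s ^ (((k:ℝ) - 1) * p) := by
          rw [← Real.rpow_natCast, ← Real.rpow_mul hs0.le, Nat.cast_pred (Nat.pos_of_ne_zero hk)]
        have e2 : ((s ^ k) ^ N) = s ^ ((k * N : ℝ)) := by
          rw [← pow_mul, ← Real.rpow_natCast]; push_cast; rfl
        rw [e1, e2, ← div_eq_mul_inv, div_le_one (by positivity)]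
        exact Real.rpow_le_rpow_of_exponent_ge hs0 hs.2 hkp
    _ = _ := by simp

theorem aux_avg {N : ℕ} (F : EuclideanSpace ℝ (Fin N) → ENNReal) (hF : Measurable F) (R : ℝ) :
    ∫⁻ z, ∫⁻ x in ball z R, F x = volume (ball (0 : EuclideanSpace ℝ (Fin N)) R) * ∫⁻ x, F x := by
  have h1 : ∀ z, ∫⁻ x in ball z R, F x =
      ∫⁻ x, {w : EuclideanSpace ℝ (Fin N) × EuclideanSpace ℝ (Fin N) |
        dist w.2 w.1 < R}.indicator (fun w => F w.2) (z, x) := by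
    intro z
    rw [← lintegral_indicator measurableSet_ball]
    rfl
  have hm : MeasurableSet {w : EuclideanSpace ℝ (Fin N) × EuclideanSpace ℝ (Fin N) |
        dist w.2 w.1 < R} := by
    apply IsOpen.measurableSet
    exact isOpen_lt (by fun_prop) (by fun_prop)
  simp_rw [h1]
  rw [lintegral_lintegral_swap]
  · have h2 : ∀ x, ∫⁻ z, {w : EuclideanSpace ℝ (Fin N) × EuclideanSpace ℝ (Fin N) |
        dist w.2 w.1 < R}.indicator (fun w => F w.2) (z, x) =
        volume (ball (0 : EuclideanSpace ℝ (Fin N)) R) * F x := by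
      intro x
      have : ∀ z, {w : EuclideanSpace ℝ (Fin N) × EuclideanSpace ℝ (Fin N) |
        dist w.2 w.1 < R}.indicator (fun w => F w.2) (z, x) =
          (ball x R).indicator (fun _ => F x) z := by
        intro z
        by_cases hz : dist x z < R
        · have hz' : z ∈ ball x R := by rwa [mem_ball, dist_comm]
          rw [indicator_of_mem hz', indicator_of_mem]
          exact hz
        · have hz' : z ∉ ball x R := by rwa [mem_ball, dist_comm]
          rw [indicator_of_notMem hz', indicator_of_notMem]
          exact hz
      simp_rw [this]
      rw [lintegral_indicator measurableSet_ball, setLIntegral_const, mul_comm,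
        Measure.addHaar_ball_center]
    simp_rw [h2]
    rw [lintegral_const_mul _ hF]
  · exact ((hF.comp measurable_snd).indicator hm).aemeasurable

theorem aux_poincare {N : ℕ} (p : ℝ) (hp1 : 1 ≤ p) (hp : (N:ℝ) < p)
    (Ω : Set (EuclideanSpace ℝ (Fin N))) (hc : Ωᶜ.Nonempty) (R : ℝ) (hR : 0 < R)
    (hb : ∀ x, infDist x Ωᶜ < R) :
    ∃ C : ENNReal, C ≠ ⊤ ∧ ∀ u : EuclideanSpace ℝ (Fin N) → ℝ, ContDiff ℝ 1 u →
      (∀ y ∈ Ωᶜ, u y = 0) → ∫⁻ x, ‖u x‖ₑ ^ p ≤ C * ∫⁻ x, ‖fderiv ℝ u x‖ₑ ^ p := by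
  obtain ⟨k, hk⟩ := exists_nat_ge (p / (p - N))
  have hpN : 0 < p - N := by linarith
  have hkp : (k * N : ℝ) ≤ (k - 1) * p := by
    rw [div_le_iff₀ hpN] at hk; linarith
  have hk0 : k ≠ 0 := by
    rintro rfl
    simp at hkp; linarith
  have hp0 : 0 ≤ p := by linarith
  set V := volume (ball (0 : EuclideanSpace ℝ (Fin N)) R)
  set V3 := volume (ball (0 : EuclideanSpace ℝ (Fin N)) (3 * R))
  set K := ENNReal.ofReal (k * (2 * R)) ^ p
  have hV : V ≠ 0 := (measure_ball_pos _ _ hR).ne'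
  have hVt : V ≠ ⊤ := measure_ball_lt_top.ne
  have hK : K ≠ ⊤ := ENNReal.rpow_ne_top_of_nonneg hp0 ENNReal.ofReal_ne_top
  refine ⟨V⁻¹ * (K * V3), ENNReal.mul_ne_top (ENNReal.inv_ne_top.2 hV)
    (ENNReal.mul_ne_top hK measure_ball_lt_top.ne), ?_⟩
  intro u hu hu0
  have hd : Continuous (fderiv ℝ u) := hu.continuous_fderiv one_ne_zero
  have hGm : Measurable fun x => ‖fderiv ℝ u x‖ₑ ^ p := by
    have : Measurable (fderiv ℝ u) := hd.measurable
    exact this.enorm.pow_const p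
  have hFm : Measurable fun x => ‖u x‖ₑ ^ p := by
    have : Measurable u := hu.continuous.measurable
    exact this.enorm.pow_const p
  have hpt : ∀ z, ∫⁻ x in ball z R, ‖u x‖ₑ ^ p ≤
      K * ∫⁻ x in ball z (3 * R), ‖fderiv ℝ u x‖ₑ ^ p := by
    intro z
    obtain ⟨y, hy, hyz⟩ := (infDist_lt_iff hc).1 (hb z)
    calc ∫⁻ x in ball z R, ‖u x‖ₑ ^ p ≤ ∫⁻ x in ball y (2 * R), ‖u x‖ₑ ^ p :=
          lintegral_mono_set (ball_subset_ball' (by linarith))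
      _ ≤ K * ∫⁻ x in ball y (2 * R), ‖fderiv ℝ u x‖ₑ ^ p :=
          aux_ball p hp1 u hu y (hu0 y hy) k hk0 hkp _
      _ ≤ _ := by
          gcongr
          exact ball_subset_ball' (by rw [dist_comm]; linarith)
  have hI := lintegral_mono (μ := volume) hpt
  rw [aux_avg _ hFm, lintegral_const_mul', aux_avg _ hGm] at hI
  · calc ∫⁻ x, ‖u x‖ₑ ^ p = V⁻¹ * (V * ∫⁻ x, ‖u x‖ₑ ^ p) := by
          rw [← mul_assoc, ENNReal.inv_mul_cancel hV hVt, one_mul]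
      _ ≤ V⁻¹ * (K * (V3 * ∫⁻ x, ‖fderiv ℝ u x‖ₑ ^ p)) := by gcongr
      _ = _ := by ring
  · exact hK

theorem aux_grad {N : ℕ} (u : EuclideanSpace ℝ (Fin N) → ℝ) (x : EuclideanSpace ℝ (Fin N)) :
    ‖gradient u x‖ = ‖fderiv ℝ u x‖ := by
  rw [gradient, LinearIsometryEquiv.norm_map]

theorem aux_full1 {N : ℕ} (p : ℝ) (hp : 0 < p) (Ω : Set (EuclideanSpace ℝ (Fin N)))
    (u : EuclideanSpace ℝ (Fin N) → ℝ) (hs : tsupport u ⊆ Ω) :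
    ∫ x in Ω, |u x| ^ p = ∫ x, |u x| ^ p := by
  apply setIntegral_eq_integral_of_forall_compl_eq_zero
  intro x hx
  rw [image_eq_zero_of_notMem_tsupport (fun h => hx (hs h)), abs_zero, Real.zero_rpow hp.ne']

theorem aux_full2 {N : ℕ} (p : ℝ) (hp : 0 < p) (Ω : Set (EuclideanSpace ℝ (Fin N)))
    (u : EuclideanSpace ℝ (Fin N) → ℝ) (hs : tsupport u ⊆ Ω) :
    ∫ x in Ω, ‖gradient u x‖ ^ p = ∫ x, ‖fderiv ℝ u x‖ ^ p := by
  simp_rw [aux_grad]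
  apply setIntegral_eq_integral_of_forall_compl_eq_zero
  intro x hx
  rw [image_eq_zero_of_notMem_tsupport (f := fderiv ℝ u)
    (fun h => hx (hs (tsupport_fderiv_subset ℝ h))), norm_zero, Real.zero_rpow hp.ne']

theorem aux_cmul {N : ℕ} (p : ℝ) (Ω : Set (EuclideanSpace ℝ (Fin N)))
    (u : EuclideanSpace ℝ (Fin N) → ℝ) (hu : ContDiff ℝ (⊤ : ℕ∞) u) (c : ℝ) (hc : 0 ≤ c) :
    ∫ x in Ω, ‖gradient (fun y => c * u y) x‖ ^ p = c ^ p * ∫ x in Ω, ‖gradient u x‖ ^ p := by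
  rw [← integral_const_mul]
  congr 1; ext x
  have hd : DifferentiableAt ℝ u x := (hu.differentiable (by simp)) x
  rw [aux_grad, aux_grad, fderiv_const_mul hd, norm_smul, Real.norm_of_nonneg hc,
    Real.mul_rpow hc (norm_nonneg _)]

theorem aux_lam {N : ℕ} (p : ℝ) (hp : 0 < p) (Ω : Set (EuclideanSpace ℝ (Fin N)))
    (u : EuclideanSpace ℝ (Fin N) → ℝ) (hu : ContDiff ℝ (⊤ : ℕ∞) u) (hc : HasCompactSupport u)
    (hs : tsupport u ⊆ Ω) (hA : 0 < ∫ x in Ω, |u x| ^ p) :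
    (∫ x in Ω, ‖gradient u x‖ ^ p) / (∫ x in Ω, |u x| ^ p) ∈
      {E : ℝ | ∃ ψ : EuclideanSpace ℝ (Fin N) → ℝ, ContDiff ℝ (⊤ : ℕ∞) ψ ∧
    HasCompactSupport ψ ∧ tsupport ψ ⊆ Ω ∧
    (∫ x in Ω, |ψ x| ^ p) = 1 ∧
    E = ∫ x in Ω, ‖gradient ψ x‖ ^ p} := by
  set A := ∫ x in Ω, |u x| ^ p with hAdef
  have hcp : (A ^ (-(1 / p))) ^ p = A⁻¹ := by
    rw [← Real.rpow_mul hA.le, neg_mul, one_div_mul_cancel hp.ne', Real.rpow_neg_one]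
  have hc0 : 0 ≤ A ^ (-(1 / p)) := by positivity
  refine ⟨fun y => A ^ (-(1 / p)) * u y, contDiff_const.mul hu, hc.mul_left,
    (tsupport_mul_subset_right).trans hs, ?_, ?_⟩
  · simp_rw [abs_mul, abs_of_nonneg hc0, Real.mul_rpow hc0 (abs_nonneg _)]
    rw [integral_const_mul, hcp, ← hAdef, inv_mul_cancel₀ hA.ne']
  · rw [aux_cmul p Ω u hu _ hc0, hcp, div_eq_inv_mul]

theorem aux_bdd {N : ℕ} (p q : ℝ) (Ω : Set (EuclideanSpace ℝ (Fin N))) :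
    BddBelow {E : ℝ | ∃ ψ : EuclideanSpace ℝ (Fin N) → ℝ, ContDiff ℝ (⊤ : ℕ∞) ψ ∧
    HasCompactSupport ψ ∧ tsupport ψ ⊆ Ω ∧
    (∫ x in Ω, |ψ x| ^ q) = 1 ∧
    E = ∫ x in Ω, ‖gradient ψ x‖ ^ p} := by
  refine ⟨0, ?_⟩
  rintro E ⟨ψ, -, -, -, -, rfl⟩
  exact integral_nonneg fun x => by positivity

theorem aux_cont_rpow {N : ℕ} (p : ℝ) (hp : 0 < p) (u : EuclideanSpace ℝ (Fin N) → ℝ)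
    (hu : Continuous u) (hc : HasCompactSupport u) :
    Continuous (fun x => |u x| ^ p) ∧ HasCompactSupport (fun x => |u x| ^ p) := by
  refine ⟨hu.abs.rpow_const fun x => Or.inr hp.le, hc.mono ?_⟩
  intro x hx hx'
  apply hx
  simp only [hx', abs_zero, Real.zero_rpow hp.ne']

theorem aux_nonempty {N : ℕ} (p : ℝ) (hp : 0 < p) (Ω : Set (EuclideanSpace ℝ (Fin N)))
    (hΩ : IsOpen Ω) (hne : Ω.Nonempty) :
    {E : ℝ | ∃ ψ : EuclideanSpace ℝ (Fin N) → ℝ, ContDiff ℝ (⊤ : ℕ∞) ψ ∧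
    HasCompactSupport ψ ∧ tsupport ψ ⊆ Ω ∧
    (∫ x in Ω, |ψ x| ^ p) = 1 ∧
    E = ∫ x in Ω, ‖gradient ψ x‖ ^ p}.Nonempty := by
  obtain ⟨x, hx⟩ := hne
  obtain ⟨f, hf1, hf2, hf3, -, hf5⟩ := exists_contDiff_tsupport_subset (n := ⊤) (hΩ.mem_nhds hx)
  refine ⟨_, aux_lam p hp Ω f hf3 hf2 hf1 ?_⟩
  rw [aux_full1 p hp Ω f hf1]
  obtain ⟨h1, h2⟩ := aux_cont_rpow p hp f hf3.continuous hf2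
  refine h1.integral_pos_of_hasCompactSupport_nonneg_nonzero h2 (fun x => by positivity) (x := x) ?_
  simp [hf5]

theorem aux_resc {N : ℕ} (p : ℝ) (hp : 0 < p) (Ω : Set (EuclideanSpace ℝ (Fin N)))
    (x : EuclideanSpace ℝ (Fin N)) (s : ℝ) (hs : 0 < s) (hb : ball x s ⊆ Ω) (E : ℝ)
    (hE : E ∈ {E : ℝ | ∃ ψ : EuclideanSpace ℝ (Fin N) → ℝ, ContDiff ℝ (⊤ : ℕ∞) ψ ∧
    HasCompactSupport ψ ∧ tsupport ψ ⊆ ball (0 : EuclideanSpace ℝ (Fin N)) 1 ∧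
    (∫ x in ball (0 : EuclideanSpace ℝ (Fin N)) 1, |ψ x| ^ p) = 1 ∧
    E = ∫ x in ball (0 : EuclideanSpace ℝ (Fin N)) 1, ‖gradient ψ x‖ ^ p}) :
    lambdaPQ p p Ω * s ^ p ≤ E := by
  obtain ⟨ψ, h1, h2, h3, h4, rfl⟩ := hE
  rw [aux_full1 p hp _ ψ h3] at h4
  rw [aux_full2 p hp _ ψ h3]
  let e : EuclideanSpace ℝ (Fin N) ≃ₜ EuclideanSpace ℝ (Fin N) :=
    (Homeomorph.subRight x).trans (Homeomorph.smulOfNeZero s⁻¹ (inv_ne_zero hs.ne'))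
  set φ : EuclideanSpace ℝ (Fin N) → ℝ := fun y => ψ (s⁻¹ • (y - x)) with hφ
  have hφe : φ = ψ ∘ e := rfl
  have g1 : ContDiff ℝ (⊤ : ℕ∞) φ :=
    h1.comp (by fun_prop)
  have g2 : HasCompactSupport φ := by rw [hφe]; exact h2.comp_homeomorph e
  have g3 : tsupport φ ⊆ Ω := by
    intro y hy
    have hy' : e y ∈ tsupport ψ := by
      rw [hφe] at hy
      exact tsupport_comp_subset_preimage ψ e.continuous hy
    have := h3 hy'
    apply hb
    simp only [mem_ball, dist_zero_right] at this
    change ‖s⁻¹ • (y - x)‖ < 1 at this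
    rw [norm_smul, norm_inv, Real.norm_of_nonneg hs.le, inv_mul_lt_iff₀ hs, mul_one] at this
    rwa [mem_ball, dist_eq_norm]
  have g4 : ∫ y, |φ y| ^ p = s ^ N := by
    rw [hφ, integral_sub_right_eq_self (fun y => |ψ (s⁻¹ • y)| ^ p) x,
      Measure.integral_comp_smul volume (fun y => |ψ y| ^ p), h4, finrank_euclideanSpace_fin,
      abs_of_pos (by positivity)]
    simp
  have hfd : ∀ y, fderiv ℝ φ y = s⁻¹ • fderiv ℝ ψ (s⁻¹ • (y - x)) := by
    intro y
    rw [hφ, fderiv_comp_sub (f := fun z => ψ (s⁻¹ • z)), fderiv_comp_smul]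
  have g5 : ∫ y, ‖fderiv ℝ φ y‖ ^ p = s ^ N * (s ^ p)⁻¹ * ∫ y, ‖fderiv ℝ ψ y‖ ^ p := by
    simp_rw [hfd, norm_smul, Real.norm_of_nonneg (inv_nonneg.2 hs.le),
      Real.mul_rpow (inv_nonneg.2 hs.le) (norm_nonneg _)]
    rw [integral_const_mul,
      integral_sub_right_eq_self (fun y => ‖fderiv ℝ ψ (s⁻¹ • y)‖ ^ p) x,
      Measure.integral_comp_smul volume (fun y => ‖fderiv ℝ ψ y‖ ^ p), finrank_euclideanSpace_fin,
      abs_of_pos (by positivity), Real.inv_rpow hs.le]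
    simp
    ring
  have hA : 0 < ∫ y in Ω, |φ y| ^ p := by
    rw [aux_full1 p hp _ φ g3, g4]; positivity
  have := csInf_le (aux_bdd p p Ω) (aux_lam p hp Ω φ g1 g2 g3 hA)
  rw [aux_full1 p hp _ φ g3, aux_full2 p hp _ φ g3, g4, g5] at this
  have hsp : 0 < s ^ p := by positivity
  rw [← le_div_iff₀ hsp]
  refine this.trans (le_of_eq ?_)
  field_simp

theorem aux_hardy {N : ℕ} (p : ℝ) (hp : 0 < p)
    (Ω : Set (EuclideanSpace ℝ (Fin N))) (hΩ : IsOpen Ω) (hc : Ωᶜ.Nonempty)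
    (r : ℝ) (hr0 : 0 < r) (hr : ∀ x, infDist x Ωᶜ ≤ r)
    (u : EuclideanSpace ℝ (Fin N) → ℝ) (hu : ContDiff ℝ (⊤ : ℕ∞) u) (hcs : HasCompactSupport u)
    (hs : tsupport u ⊆ Ω) (h1 : ∫ x in Ω, |u x| ^ p = 1) :
    hardyP p Ω ≤ (∫ x in Ω, ‖gradient u x‖ ^ p) * r ^ p := by
  have hpos : ∀ x ∈ Ω, 0 < infDist x Ωᶜ := fun x hx =>
    (hΩ.isClosed_compl.notMem_iff_infDist_pos hc).1 (by simpa using hx)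
  set w : EuclideanSpace ℝ (Fin N) → ℝ := fun x => (|u x| / infDist x Ωᶜ) ^ p with hw
  have hwc : Continuous w := by
    rw [continuous_iff_continuousAt]
    intro x
    by_cases hx : x ∈ Ω
    · have : ContinuousAt (fun x => |u x| / infDist x Ωᶜ) x :=
        (hu.continuous.abs.continuousAt).div (continuous_infDist_pt _).continuousAt (hpos x hx).ne'
      exact this.rpow_const (Or.inr hp.le)
    · have hx' : x ∉ tsupport u := fun h => hx (hs h)
      rw [notMem_tsupport_iff_eventuallyEq] at hx'
      have : w =ᶠ[nhds x] fun _ => 0 := by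
        filter_upwards [hx'] with y hy
        simp [hw, hy, Real.zero_rpow hp.ne']
      exact continuousAt_const.congr this.symm
  have hwcs : HasCompactSupport w := by
    refine hcs.mono ?_
    intro x hx hx'
    apply hx
    simp [hw, hx', Real.zero_rpow hp.ne']
  have hwi : Integrable w := hwc.integrable_of_hasCompactSupport hwcs
  obtain ⟨c1, c2⟩ := aux_cont_rpow p hp u hu.continuous hcs
  have hui := c1.integrable_of_hasCompactSupport c2 (μ := volume)
  set D := ∫ x in Ω, w x with hD
  have hDr : 1 ≤ r ^ p * D := by
    rw [← h1, hD, ← integral_const_mul]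
    apply setIntegral_mono_on hui.integrableOn (hwi.integrableOn.const_mul _) hΩ.measurableSet
    intro x hx
    have hd := hpos x hx
    rw [hw]
    simp only
    rw [← Real.mul_rpow hr0.le (by positivity)]
    apply Real.rpow_le_rpow (abs_nonneg _) _ hp.le
    rw [mul_div_assoc', le_div_iff₀ hd, mul_comm]
    exact mul_le_mul_of_nonneg_right (hr x) (abs_nonneg _)
  have hrp : 0 < r ^ p := by positivity
  have hD0 : 0 < D := by
    by_contra h
    push Not at h
    nlinarith
  have hcp : (D ^ (-(1 / p))) ^ p = D⁻¹ := by
    rw [← Real.rpow_mul hD0.le, neg_mul, one_div_mul_cancel hp.ne', Real.rpow_neg_one]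
  have hc0 : 0 ≤ D ^ (-(1 / p)) := by positivity
  have hE0 : 0 ≤ ∫ x in Ω, ‖gradient u x‖ ^ p := integral_nonneg fun x => by positivity
  have key : hardyP p Ω ≤ D⁻¹ * ∫ x in Ω, ‖gradient u x‖ ^ p := by
    apply csInf_le
    · refine ⟨0, ?_⟩
      rintro E ⟨ψ, -, -, -, -, rfl⟩
      exact integral_nonneg fun x => by positivity
    refine ⟨fun y => D ^ (-(1 / p)) * u y, contDiff_const.mul hu, hcs.mul_left,
      (tsupport_mul_subset_right).trans hs, ?_, ?_⟩
    · have : ∀ x, (|D ^ (-(1 / p)) * u x| / infDist x Ωᶜ) ^ p = D⁻¹ * w x := by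
        intro x
        rw [abs_mul, abs_of_nonneg hc0, mul_div_assoc,
          Real.mul_rpow hc0 (div_nonneg (abs_nonneg _) infDist_nonneg), hcp]
      simp_rw [this]
      rw [integral_const_mul, ← hD, inv_mul_cancel₀ hD0.ne']
    · rw [aux_cmul p Ω u hu _ hc0, hcp]
  refine key.trans ?_
  rw [mul_comm]
  refine mul_le_mul_of_nonneg_left ?_ hE0
  rw [inv_le_iff_one_le_mul₀ hD0]
  exact hDr

theorem aux_pos {N : ℕ} (p : ℝ) (hp1 : 1 ≤ p) (hp : (N:ℝ) < p)
    (Ω : Set (EuclideanSpace ℝ (Fin N))) (hΩ : IsOpen Ω) (hne : Ω.Nonempty) (hc : Ωᶜ.Nonempty)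
    (hb : BddAbove (Set.range fun x => Metric.infDist x Ωᶜ)) : 0 < lambdaPQ p p Ω := by
  have hp0 : 0 < p := by linarith
  obtain ⟨M, hM⟩ := hb
  have hM' : ∀ x, infDist x Ωᶜ ≤ M := fun x => hM ⟨x, rfl⟩
  have hM0 : 0 ≤ M := infDist_nonneg.trans (hM' 0)
  obtain ⟨C, hC, hCu⟩ := aux_poincare p hp1 hp Ω hc (M + 1) (by linarith)
    (fun x => by linarith [hM' x])
  have hC0 : 0 ≤ C.toReal := ENNReal.toReal_nonneg
  have : 1 / (C.toReal + 1) ≤ lambdaPQ p p Ω := by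
    apply le_csInf (aux_nonempty p hp0 Ω hΩ hne)
    rintro E ⟨u, h1, h2, h3, h4, rfl⟩
    rw [aux_full1 p hp0 _ u h3] at h4
    rw [aux_full2 p hp0 _ u h3]
    have hu1 : ContDiff ℝ 1 u := h1.of_le (by exact_mod_cast le_top)
    have hd : Continuous (fderiv ℝ u) := hu1.continuous_fderiv one_ne_zero
    have := hCu u hu1
      (fun y hy => image_eq_zero_of_notMem_tsupport fun h => hy (h3 h))
    obtain ⟨c1, c2⟩ := aux_cont_rpow p hp0 u h1.continuous h2
    have i1 := c1.integrable_of_hasCompactSupport c2 (μ := volume)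
    have i2 : Integrable (fun x => ‖fderiv ℝ u x‖ ^ p) := by
      apply Continuous.integrable_of_hasCompactSupport
      · exact hd.norm.rpow_const fun x => Or.inr hp0.le
      · refine (h2.fderiv ℝ).mono ?_
        intro x hx hx'
        apply hx
        simp only [hx', norm_zero, Real.zero_rpow hp0.ne']
    have j1 : ∫⁻ x, ‖u x‖ₑ ^ p = ENNReal.ofReal (∫ x, |u x| ^ p) := by
      rw [ofReal_integral_eq_lintegral_ofReal i1 (Filter.Eventually.of_forall fun x => by positivity)]
      congr 1; ext x
      rw [← ofReal_norm, ENNReal.ofReal_rpow_of_nonneg (norm_nonneg _) hp0.le, Real.norm_eq_abs]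
    have j2 : ∫⁻ x, ‖fderiv ℝ u x‖ₑ ^ p = ENNReal.ofReal (∫ x, ‖fderiv ℝ u x‖ ^ p) := by
      rw [ofReal_integral_eq_lintegral_ofReal i2 (Filter.Eventually.of_forall fun x => by positivity)]
      congr 1; ext x
      rw [← ofReal_norm, ENNReal.ofReal_rpow_of_nonneg (norm_nonneg _) hp0.le]
    have hE0 : 0 ≤ ∫ x, ‖fderiv ℝ u x‖ ^ p := integral_nonneg fun x => by positivity
    rw [j1, j2, h4, ← ENNReal.ofReal_toReal hC, ← ENNReal.ofReal_mul hC0,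
      ENNReal.ofReal_le_ofReal_iff (by positivity)] at this
    rw [div_le_iff₀ (by linarith)]
    nlinarith
  exact lt_of_lt_of_le (by positivity) this

/-- For `p > N` and `Ω ⊊ ℝ^N` open with finite inradius `r_Ω`,
`𝔥_p(Ω) ≤ λ_p(Ω) r_Ω^p ≤ λ_p(B_1)`; moreover, for every nonempty open `Ω' ⊊ ℝ^N`,
`λ_p(Ω') > 0` if and only if `r_{Ω'} < ∞`. -/
theorem lambda_p_inradius_bounds {N : ℕ} (hN : 0 < N) (p : ℝ) (hp : (N : ℝ) < p)
    (Ω : Set (EuclideanSpace ℝ (Fin N))) (hΩ : IsOpen Ω) (hne : Ω ≠ Set.univ)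
    (hΩne : Ω.Nonempty)
    (rΩ : ℝ) (hr : IsLUB (Set.range fun x => Metric.infDist x Ωᶜ) rΩ) :
    hardyP p Ω ≤ lambdaPQ p p Ω * rΩ ^ p ∧
    lambdaPQ p p Ω * rΩ ^ p ≤ lambdaPQ p p (Metric.ball (0 : EuclideanSpace ℝ (Fin N)) 1) ∧
    (∀ Ω' : Set (EuclideanSpace ℝ (Fin N)), IsOpen Ω' → Ω' ≠ Set.univ → Ω'.Nonempty →
      (0 < lambdaPQ p p Ω' ↔ BddAbove (Set.range fun x => Metric.infDist x Ω'ᶜ))) := by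

  have hN1 : (1:ℝ) ≤ N := by exact_mod_cast hN
  have hp1 : 1 ≤ p := by linarith
  have hp0 : 0 < p := by linarith
  have hc : Ωᶜ.Nonempty := nonempty_compl.2 hne
  have hle : ∀ x, infDist x Ωᶜ ≤ rΩ := fun x => hr.1 ⟨x, rfl⟩
  have hr0 : 0 < rΩ := by
    obtain ⟨x, hx⟩ := hΩne
    exact ((hΩ.isClosed_compl.notMem_iff_infDist_pos hc).1 (by simpa using hx)).trans_le (hle x)
  have hrp : 0 < rΩ ^ p := by positivity
  have hBne := aux_nonempty p hp0 (ball (0 : EuclideanSpace ℝ (Fin N)) 1) isOpen_ball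
    (nonempty_ball.2 one_pos)
  refine ⟨?_, ?_, ?_⟩
  · rw [← div_le_iff₀ hrp]
    apply le_csInf (aux_nonempty p hp0 Ω hΩ hΩne)
    rintro E ⟨u, h1, h2, h3, h4, rfl⟩
    rw [div_le_iff₀ hrp]
    exact aux_hardy p hp0 Ω hΩ hc rΩ hr0 hle u h1 h2 h3 h4
  · apply le_csInf hBne
    intro E hE
    have hlim : Filter.Tendsto (fun t : ℝ => lambdaPQ p p Ω * t ^ p) (nhdsWithin rΩ (Iio rΩ))
        (nhds (lambdaPQ p p Ω * rΩ ^ p)) := by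
      apply Filter.Tendsto.mono_left _ nhdsWithin_le_nhds
      exact ((Real.continuousAt_rpow_const rΩ p (Or.inr hp0.le)).const_mul _).tendsto
    refine le_of_tendsto hlim ?_
    filter_upwards [Ioo_mem_nhdsLT hr0] with t ht
    obtain ⟨_, ⟨x, rfl⟩, hx, -⟩ := hr.exists_between ht.2
    exact aux_resc p hp0 Ω x t ht.1 ((ball_subset_ball hx.le).trans ball_infDist_compl_subset) E hE
  · intro Ω' hΩ' hne' hΩne'
    refine ⟨?_, aux_pos p hp1 hp Ω' hΩ' hΩne' (nonempty_compl.2 hne')⟩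
    intro hl
    by_contra hb
    obtain ⟨E, hE⟩ := hBne
    have ht := (tendsto_rpow_atTop hp0).const_mul_atTop hl
    obtain ⟨t, ht1, ht2⟩ := ((ht.eventually_gt_atTop E).and (Filter.eventually_gt_atTop 0)).exists
    rw [not_bddAbove_iff] at hb
    obtain ⟨_, ⟨x, rfl⟩, hx⟩ := hb t
    have := aux_resc p hp0 Ω' x t ht2 ((ball_subset_ball hx.le).trans ball_infDist_compl_subset) E hE
    linarith
end
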